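/- arXiv:2304.14148 — 6 statements merged into one kernel-verified Lean document; each statement's English description precedes it below -/
import Mathlib

section
/- Let b be a slowly varying function. Then there exists a function c : (0,∞) → (0,∞) such that c ≈ b on (0,∞), c is slowly varying, and c has continuous classical derivatives of all orders on (0,∞) (i.e. c is C^∞). -/
open MeasureTheory Set Filter Topology

noncomputable section

/-- `f ≈ g` on `S`: the ratio of `f` and `g` is sandwiched between two finite
positive constants on the whole of `S`. -/
def EquivOn (f g : ℝ → ℝ) (S : Set ℝ) : Prop :=
  ∃ C₁ C₂ : ℝ, 0 < C₁ ∧ C₁ ≤ C₂ ∧ ∀ t ∈ S, C₁ * g t ≤ f t ∧ f t ≤ C₂ * g t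

/-- A measurable function `b : (0,∞) → (0,∞)` (modelled as a measurable `b : ℝ → ℝ`
positive on `(0,∞)`) is slowly varying if for every `ε > 0` there exist a
non-decreasing positive function `bp` and a non-increasing positive function `bm`
on `(0,∞)` with `t ^ ε * b t ≈ bp t` and `t ^ (-ε) * b t ≈ bm t` on `(0,∞)`. -/
def SlowlyVarying (b : ℝ → ℝ) : Prop :=
  Measurable b ∧ (∀ t ∈ Ioi (0:ℝ), 0 < b t) ∧
    ∀ ε : ℝ, 0 < ε →
      ∃ bp bm : ℝ → ℝ,
        MonotoneOn bp (Ioi 0) ∧ AntitoneOn bm (Ioi 0) ∧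
        (∀ t ∈ Ioi (0:ℝ), 0 < bp t) ∧ (∀ t ∈ Ioi (0:ℝ), 0 < bm t) ∧
        EquivOn (fun t => t ^ ε * b t) bp (Ioi 0) ∧
        EquivOn (fun t => t ^ (-ε) * b t) bm (Ioi 0)


/-- A positive function equivalent to a slowly varying one is slowly varying
as soon as it is measurable. -/
theorem SlowlyVarying.of_equivOn {b c : ℝ → ℝ} (hb : SlowlyVarying b) (hc : Measurable c)
    (hpos : ∀ t ∈ Ioi (0:ℝ), 0 < c t) (h : EquivOn c b (Ioi 0)) : SlowlyVarying c := by
  have key : ∀ (ε : ℝ) (f : ℝ → ℝ), EquivOn (fun t => t ^ ε * b t) f (Ioi 0) →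
      EquivOn (fun t => t ^ ε * c t) f (Ioi 0) := by
    rintro ε f ⟨D₁, D₂, hD₁, hD, hf⟩
    obtain ⟨C₁, C₂, hC₁, hC, hcb⟩ := h
    have hC₂ : 0 < C₂ := hC₁.trans_le hC
    refine ⟨C₁ * D₁, C₂ * D₂, by positivity, by gcongr, fun t ht => ?_⟩
    have hp : 0 < t ^ ε := Real.rpow_pos_of_pos ht ε
    obtain ⟨h₁, h₂⟩ := hf t ht
    obtain ⟨h₃, h₄⟩ := hcb t ht
    constructor
    · calc C₁ * D₁ * f t = C₁ * (D₁ * f t) := by ring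
        _ ≤ C₁ * (t ^ ε * b t) := by gcongr
        _ = t ^ ε * (C₁ * b t) := by ring
        _ ≤ t ^ ε * c t := by gcongr
    · calc t ^ ε * c t ≤ t ^ ε * (C₂ * b t) := by gcongr
        _ = C₂ * (t ^ ε * b t) := by ring
        _ ≤ C₂ * (D₂ * f t) := by gcongr
        _ = C₂ * D₂ * f t := by ring
  refine ⟨hc, hpos, fun ε hε => ?_⟩
  obtain ⟨bp, bm, h₁, h₂, h₃, h₄, h₅, h₆⟩ := hb.2.2 ε hε
  exact ⟨bp, bm, h₁, h₂, h₃, h₄, key _ _ h₅, key _ _ h₆⟩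

/-- In logarithmic scale, the values of a slowly varying function at points at distance at most
one are uniformly comparable. -/
theorem SlowlyVarying.exists_comp_exp_le {b : ℝ → ℝ} (hb : SlowlyVarying b) :
    ∃ K : ℝ, 1 ≤ K ∧ ∀ x y : ℝ, |x - y| ≤ 1 → b (Real.exp y) ≤ K * b (Real.exp x) := by
  obtain ⟨-, hpos, h⟩ := hb
  obtain ⟨bp, bm, hp, hm, -, -, ⟨C₁, C₂, hC₁, hC, hbp⟩, ⟨D₁, D₂, hD₁, hD, hbm⟩⟩ := h 1 one_pos
  have hC₂ : 0 < C₂ := hC₁.trans_le hC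
  have hD₂ : 0 < D₂ := hD₁.trans_le hD
  have aux : ∀ (ε A₁ A₂ u v x y : ℝ), 0 < A₁ → 0 < A₂ → u ≤ v → ε * (x - y) ≤ 1 →
      A₁ * v ≤ Real.exp x ^ ε * b (Real.exp x) → Real.exp y ^ ε * b (Real.exp y) ≤ A₂ * u →
      b (Real.exp y) ≤ A₂ / A₁ * Real.exp 1 * b (Real.exp x) := by
    intro ε A₁ A₂ u v x y h₁ h₂ huv hxy hv hu
    have hbx := hpos _ (Real.exp_pos x)
    rw [← Real.exp_mul] at hu hv
    have h3 : Real.exp (y * ε) * b (Real.exp y) ≤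
        A₂ / A₁ * (Real.exp (x * ε) * b (Real.exp x)) := by
      calc _ ≤ A₂ * u := hu
        _ ≤ A₂ * v := by gcongr
        _ = A₂ / A₁ * (A₁ * v) := by field_simp
        _ ≤ _ := by gcongr
    have h4 : Real.exp (x * ε) ≤ Real.exp 1 * Real.exp (y * ε) := by
      rw [← Real.exp_add]
      exact Real.exp_le_exp.2 (by linarith)
    refine le_of_mul_le_mul_left ?_ (Real.exp_pos (y * ε))
    calc _ ≤ _ := h3
      _ ≤ A₂ / A₁ * (Real.exp 1 * Real.exp (y * ε) * b (Real.exp x)) := by gcongr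
      _ = _ := by ring
  have he : 1 ≤ Real.exp 1 := Real.one_le_exp zero_le_one
  refine ⟨max (C₂ / C₁) (D₂ / D₁) * Real.exp 1,
    one_le_mul_of_one_le_of_one_le (le_max_of_le_left ((one_le_div hC₁).2 hC)) he,
    fun x y hxy => ?_⟩
  have hbx := hpos _ (Real.exp_pos x)
  rw [abs_le] at hxy
  rcases le_total y x with hyx | hyx
  · refine (aux 1 C₁ C₂ _ _ x y hC₁ hC₂ (hp (Real.exp_pos y) (Real.exp_pos x)
      (Real.exp_le_exp.2 hyx)) (by linarith) (hbp _ (Real.exp_pos x)).1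
      (hbp _ (Real.exp_pos y)).2).trans ?_
    gcongr
    exact le_max_left _ _
  · refine (aux (-1) D₁ D₂ _ _ x y hD₁ hD₂ (hm (Real.exp_pos x) (Real.exp_pos y)
      (Real.exp_le_exp.2 hyx)) (by linarith) (hbm _ (Real.exp_pos x)).1
      (hbm _ (Real.exp_pos y)).2).trans ?_
    gcongr
    exact le_max_right _ _

/-- A positive measurable function on `ℝ` whose values at points at distance at most one are
uniformly comparable is equivalent to a smooth function. -/
theorem exists_contDiff_equivOn_univ {g : ℝ → ℝ} (hg : Measurable g) (hpos : ∀ x, 0 < g x)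
    {K : ℝ} (hK : 1 ≤ K) (h : ∀ x y : ℝ, |x - y| ≤ 1 → g y ≤ K * g x) :
    ∃ f : ℝ → ℝ, ContDiff ℝ (⊤ : ℕ∞) f ∧ EquivOn f g univ := by
  have hK₀ : 0 < K := one_pos.trans_le hK
  have hloc : LocallyIntegrable g volume := by
    intro x
    refine ⟨Metric.closedBall x 1, Metric.closedBall_mem_nhds x one_pos, ?_⟩
    refine Measure.integrableOn_of_bounded (M := K * g x) measure_closedBall_lt_top.ne
      hg.aestronglyMeasurable ?_
    refine (ae_restrict_mem measurableSet_closedBall).mono fun y hy => ?_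
    rw [Real.norm_of_nonneg (hpos y).le]
    rw [Metric.mem_closedBall, Real.dist_eq, abs_sub_comm] at hy
    exact h x y hy
  let φ : ContDiffBump (0 : ℝ) := ⟨1 / 2, 1, by norm_num, by norm_num⟩
  have hφ : HasCompactSupport (φ.normed volume) := φ.hasCompactSupport_normed
  refine ⟨convolution (φ.normed volume) g (ContinuousLinearMap.lsmul ℝ ℝ) volume,
    hφ.contDiff_convolution_left _ φ.contDiff_normed hloc,
    K⁻¹, K, by positivity, (inv_le_one_of_one_le₀ hK).trans hK, fun x _ => ?_⟩
  have hint : Integrable (fun t => φ.normed volume t * g (x - t)) volume :=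
    hφ.convolutionExists_left (ContinuousLinearMap.lsmul ℝ ℝ) φ.continuous_normed hloc x
  have hconst : ∀ a : ℝ, ∫ t, φ.normed volume t * a = a := fun a => by
    rw [integral_mul_const, φ.integral_normed, one_mul]
  have hnear : ∀ t, φ.normed volume t ≠ 0 → |t| ≤ 1 := fun t ht => by
    have : t ∈ Function.support (φ.normed volume) := ht
    rw [φ.support_normed_eq, mem_ball_zero_iff] at this
    exact this.le
  change K⁻¹ * g x ≤ ∫ t, φ.normed volume t * g (x - t) ∧
    ∫ t, φ.normed volume t * g (x - t) ≤ K * g x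
  constructor
  · rw [← hconst (K⁻¹ * g x)]
    refine integral_mono (φ.integrable_normed.mul_const _) hint fun t => ?_
    by_cases ht : φ.normed volume t = 0
    · simp [ht]
    · refine mul_le_mul_of_nonneg_left ?_ (φ.nonneg_normed t)
      rw [inv_mul_le_iff₀ hK₀]
      exact h _ _ (by simpa using hnear t ht)
  · rw [← hconst (K * g x)]
    refine integral_mono hint (φ.integrable_normed.mul_const _) fun t => ?_
    by_cases ht : φ.normed volume t = 0
    · simp [ht]
    · refine mul_le_mul_of_nonneg_left ?_ (φ.nonneg_normed t)
      exact h _ _ (by simpa using hnear t ht)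

/-- Every slowly varying function is equivalent to a slowly varying function which is
infinitely differentiable on `(0,∞)`. -/
theorem slowlyVarying_smooth_approx (b : ℝ → ℝ) (hb : SlowlyVarying b) :
    ∃ c : ℝ → ℝ, (∀ t ∈ Ioi (0:ℝ), 0 < c t) ∧ EquivOn c b (Ioi 0) ∧
      SlowlyVarying c ∧ ContDiffOn ℝ (⊤ : ℕ∞) c (Ioi 0) := by
  obtain ⟨K, hK, h⟩ := hb.exists_comp_exp_le
  obtain ⟨f, hf, C₁, C₂, hC₁, hC, hfg⟩ := exists_contDiff_equivOn_univ
    (hb.1.comp Real.measurable_exp) (fun x => hb.2.1 _ (Real.exp_pos x)) hK h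
  have hbound : ∀ t ∈ Ioi (0:ℝ), C₁ * b t ≤ f (Real.log t) ∧ f (Real.log t) ≤ C₂ * b t := by
    intro t ht
    simpa [Real.exp_log ht] using hfg (Real.log t) (mem_univ _)
  have hpos : ∀ t ∈ Ioi (0:ℝ), 0 < f (Real.log t) := fun t ht =>
    (mul_pos hC₁ (hb.2.1 t ht)).trans_le (hbound t ht).1
  have hequiv : EquivOn (fun t => f (Real.log t)) b (Ioi 0) := ⟨C₁, C₂, hC₁, hC, hbound⟩
  refine ⟨fun t => f (Real.log t), hpos, hequiv,
    hb.of_equivOn (hf.continuous.measurable.comp Real.measurable_log) hpos hequiv, ?_⟩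
  exact hf.comp_contDiffOn (Real.contDiffOn_log.mono fun t ht => (ne_of_gt ht : t ≠ 0))
end
end

section
/- Let b be a slowly varying function and define, for t ∈ (0,∞), b̃(t) = ∫₀^t s^{-1} b(s) ds, b̃_∞(t) = esssup_{s ∈ (0,t)} b(s), b̂(t) = ∫_t^∞ s^{-1} b(s) ds, and b̂_∞(t) = esssup_{s ∈ (t,∞)} b(s). Then there exist positive constants such that b ≲ b̃, b ≲ b̃_∞, b ≲ b̂, and b ≲ b̂_∞ on (0,∞), and each of the functions b̃, b̃_∞, b̂, b̂_∞ is slowly varying if and only if it is finite Lebesgue-almost everywhere on (0,∞). -/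
open MeasureTheory Set Filter Topology

noncomputable section

/-- `b̃(t) = ∫₀^t s⁻¹ b(s) ds`, as an extended-real-valued function. -/
def tildeB (b : ℝ → ℝ) (t : ℝ) : ENNReal :=
  ∫⁻ s in Ioc 0 t, ENNReal.ofReal (s⁻¹ * b s)

/-- `b̃_∞(t) = esssup_(s ∈ (0,t)) b(s)`, as an extended-real-valued function. -/
def tildeBinf (b : ℝ → ℝ) (t : ℝ) : ENNReal :=
  essSup (fun s => ENNReal.ofReal (b s)) (volume.restrict (Ioo 0 t))

/-- `b̂(t) = ∫_t^∞ s⁻¹ b(s) ds`, as an extended-real-valued function. -/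
def hatB (b : ℝ → ℝ) (t : ℝ) : ENNReal :=
  ∫⁻ s in Ioi t, ENNReal.ofReal (s⁻¹ * b s)

/-- `b̂_∞(t) = esssup_(s ∈ (t,∞)) b(s)`, as an extended-real-valued function. -/
def hatBinf (b : ℝ → ℝ) (t : ℝ) : ENNReal :=
  essSup (fun s => ENNReal.ofReal (b s)) (volume.restrict (Ioi t))

/-- A slowly varying function grows and decays at most like any power under dilations. -/
theorem SlowlyVarying.dilation_bounds {b : ℝ → ℝ} (hb : SlowlyVarying b) {ε : ℝ} (hε : 0 < ε) :
    ∃ C : ℝ, 0 < C ∧ ∀ l : ℝ, 1 ≤ l → ∀ u : ℝ, 0 < u →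
      b (l * u) ≤ C * l ^ ε * b u ∧ b u ≤ C * l ^ ε * b (l * u) := by
  obtain ⟨-, hpos, h⟩ := hb
  obtain ⟨bp, bm, hmono, hanti, -, -, ⟨c₁, c₂, hc₁, hc, hp⟩, ⟨d₁, d₂, hd₁, hd, hm⟩⟩ := h ε hε
  have hc₂ := hc₁.trans_le hc
  have hd₂ := hd₁.trans_le hd
  refine ⟨c₂ / c₁ + d₂ / d₁, by positivity, fun l hl u hu => ?_⟩
  have hl0 : 0 < l := one_pos.trans_le hl
  have hlu : 0 < l * u := mul_pos hl0 hu
  have hle : u ≤ l * u := le_mul_of_one_le_left hu.le hl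
  have hbu := hpos u hu
  have hblu := hpos _ hlu
  have hup : 0 < u ^ ε := Real.rpow_pos_of_pos hu ε
  have hlp : 0 < l ^ ε := Real.rpow_pos_of_pos hl0 ε
  constructor
  · have h1 := (hm _ hlu).2
    have h2 := (hm _ hu).1
    have h3 := hanti hu hlu hle
    simp only [Real.rpow_neg hlu.le, Real.rpow_neg hu.le, Real.mul_rpow hl0.le hu.le] at h1 h2
    have h4 : (l ^ ε * u ^ ε)⁻¹ * b (l * u) ≤ d₂ / d₁ * ((u ^ ε)⁻¹ * b u) :=
      calc _ ≤ d₂ * bm (l * u) := h1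
        _ ≤ d₂ * bm u := by gcongr
        _ = d₂ / d₁ * (d₁ * bm u) := by field_simp
        _ ≤ _ := by gcongr
    have h5 : b (l * u) ≤ d₂ / d₁ * l ^ ε * b u := by
      calc b (l * u) = (l ^ ε * u ^ ε) * ((l ^ ε * u ^ ε)⁻¹ * b (l * u)) := by field_simp
        _ ≤ (l ^ ε * u ^ ε) * (d₂ / d₁ * ((u ^ ε)⁻¹ * b u)) := by gcongr
        _ = _ := by field_simp
    refine h5.trans ?_
    gcongr
    exact le_add_of_nonneg_left (by positivity)
  · have h1 := (hp _ hu).2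
    have h2 := (hp _ hlu).1
    have h3 := hmono hu hlu hle
    simp only [Real.mul_rpow hl0.le hu.le] at h1 h2
    have h4 : u ^ ε * b u ≤ c₂ / c₁ * (l ^ ε * u ^ ε * b (l * u)) :=
      calc _ ≤ c₂ * bp u := h1
        _ ≤ c₂ * bp (l * u) := by gcongr
        _ = c₂ / c₁ * (c₁ * bp (l * u)) := by field_simp
        _ ≤ _ := by gcongr
    have h5 : b u ≤ c₂ / c₁ * l ^ ε * b (l * u) := by
      refine le_of_mul_le_mul_left (h4.trans_eq ?_) hup
      ring
    refine h5.trans ?_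
    gcongr
    exact le_add_of_nonneg_right (by positivity)

theorem exists_antitoneOn_equivOn {f : ℝ → ℝ} {C : ℝ} (hf : ∀ t ∈ Ioi (0 : ℝ), 0 < f t)
    (h : ∀ s t, 0 < s → s ≤ t → f t ≤ C * f s) :
    ∃ g : ℝ → ℝ, AntitoneOn g (Ioi 0) ∧ (∀ t ∈ Ioi (0 : ℝ), 0 < g t) ∧ EquivOn f g (Ioi 0) := by
  have hC : 1 ≤ C := by
    have := h 1 1 one_pos le_rfl
    have h1 := hf 1 (mem_Ioi.2 one_pos)
    nlinarith
  have hC0 := one_pos.trans_le hC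
  have hbdd : ∀ t, 0 < t → BddAbove (f '' Ici t) := fun t ht =>
    ⟨C * f t, by rintro _ ⟨s, hs, rfl⟩; exact h t s ht hs⟩
  have hle : ∀ t, 0 < t → f t ≤ sSup (f '' Ici t) := fun t ht =>
    le_csSup (hbdd t ht) ⟨t, self_mem_Ici, rfl⟩
  refine ⟨fun t => sSup (f '' Ici t), ?_, fun t ht => (hf t ht).trans_le (hle t ht),
    C⁻¹, 1, by positivity, inv_le_one_of_one_le₀ hC, fun t ht => ⟨?_, by simpa using hle t ht⟩⟩
  · intro s hs t _ hst
    exact csSup_le_csSup (hbdd s hs) (nonempty_Ici.image f) (image_mono (Ici_subset_Ici.2 hst))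
  · rw [inv_mul_le_iff₀ hC0]
    refine csSup_le (nonempty_Ici.image f) ?_
    rintro _ ⟨s, hs, rfl⟩
    exact h t s ht hs

theorem exists_monotoneOn_equivOn {f : ℝ → ℝ} {C : ℝ} (hf : ∀ t ∈ Ioi (0 : ℝ), 0 < f t)
    (h : ∀ s t, 0 < s → s ≤ t → f s ≤ C * f t) :
    ∃ g : ℝ → ℝ, MonotoneOn g (Ioi 0) ∧ (∀ t ∈ Ioi (0 : ℝ), 0 < g t) ∧ EquivOn f g (Ioi 0) := by
  have hC : 1 ≤ C := by
    have := h 1 1 one_pos le_rfl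
    have h1 := hf 1 (mem_Ioi.2 one_pos)
    nlinarith
  have hC0 := one_pos.trans_le hC
  have hbdd : ∀ t, BddAbove (f '' Ioc 0 t) := fun t =>
    ⟨C * f t, by rintro _ ⟨s, hs, rfl⟩; exact h s t hs.1 hs.2⟩
  have hle : ∀ t, 0 < t → f t ≤ sSup (f '' Ioc 0 t) := fun t ht =>
    le_csSup (hbdd t) ⟨t, right_mem_Ioc.2 ht, rfl⟩
  refine ⟨fun t => sSup (f '' Ioc 0 t), ?_, fun t ht => (hf t ht).trans_le (hle t ht),
    C⁻¹, 1, by positivity, inv_le_one_of_one_le₀ hC, fun t ht => ⟨?_, by simpa using hle t ht⟩⟩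
  · intro s hs t _ hst
    exact csSup_le_csSup (hbdd t) ((nonempty_Ioc.2 hs).image f)
      (image_mono (Ioc_subset_Ioc_right hst))
  · rw [inv_mul_le_iff₀ hC0]
    refine csSup_le ((nonempty_Ioc.2 ht).image f) ?_
    rintro _ ⟨s, hs, rfl⟩
    exact h s t hs.1 hs.2

theorem slowlyVarying_of_dilation_bounds {f : ℝ → ℝ} (hmeas : Measurable f)
    (hf : ∀ t ∈ Ioi (0 : ℝ), 0 < f t)
    (hup : ∀ ε : ℝ, 0 < ε → ∃ C : ℝ, ∀ l : ℝ, 1 ≤ l → ∀ u : ℝ, 0 < u →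
      f (l * u) ≤ C * l ^ ε * f u)
    (hdown : ∀ ε : ℝ, 0 < ε → ∃ C : ℝ, ∀ l : ℝ, 1 ≤ l → ∀ u : ℝ, 0 < u →
      f u ≤ C * l ^ ε * f (l * u)) : SlowlyVarying f := by
  refine ⟨hmeas, hf, fun ε hε => ?_⟩
  obtain ⟨C, hC⟩ := hdown ε hε
  obtain ⟨D, hD⟩ := hup ε hε
  obtain ⟨bp, hp, hp0, hpe⟩ := exists_monotoneOn_equivOn (f := fun t => t ^ ε * f t) (C := C)
    (fun t ht => mul_pos (Real.rpow_pos_of_pos ht ε) (hf t ht)) (by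
      intro s t hs hst
      have h := hC (t / s) ((one_le_div hs).2 hst) s hs
      rw [div_mul_cancel₀ _ hs.ne', Real.div_rpow (hs.le.trans hst) hs.le] at h
      have hsp := Real.rpow_pos_of_pos hs ε
      calc s ^ ε * f s ≤ s ^ ε * (C * (t ^ ε / s ^ ε) * f t) := by gcongr
        _ = _ := by field_simp)
  obtain ⟨bm, hm, hm0, hme⟩ := exists_antitoneOn_equivOn (f := fun t => t ^ (-ε) * f t) (C := D)
    (fun t ht => mul_pos (Real.rpow_pos_of_pos ht _) (hf t ht)) (by
      intro s t hs hst
      have ht := hs.trans_le hst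
      have h := hD (t / s) ((one_le_div hs).2 hst) s hs
      rw [div_mul_cancel₀ _ hs.ne', Real.div_rpow ht.le hs.le] at h
      have hsp := Real.rpow_pos_of_pos hs ε
      have htp := Real.rpow_pos_of_pos ht ε
      simp only [Real.rpow_neg hs.le, Real.rpow_neg ht.le]
      calc (t ^ ε)⁻¹ * f t ≤ (t ^ ε)⁻¹ * (D * (t ^ ε / s ^ ε) * f s) := by gcongr
        _ = _ := by field_simp)
  exact ⟨bp, bm, hp, hm, hp0, hm0, hpe, hme⟩

theorem ae_lt_top_of_slowlyVarying_toReal {F : ℝ → ENNReal}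
    (h : SlowlyVarying fun t => (F t).toReal) :
    ∀ᵐ t ∂(volume.restrict (Ioi (0 : ℝ))), F t < ⊤ := by
  filter_upwards [ae_restrict_mem measurableSet_Ioi] with t ht
  exact (ENNReal.toReal_pos_iff.1 (h.2.1 t ht)).2

theorem exists_mem_Ioo_of_ae_restrict {p : ℝ → Prop} {S : Set ℝ}
    (h : ∀ᵐ t ∂(volume.restrict S), p t) {x y : ℝ} (hxy : x < y) (hS : Ioo x y ⊆ S) :
    ∃ t ∈ Ioo x y, p t := by
  have h' := ae_restrict_of_ae_restrict_of_subset hS h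
  have : (ae (volume.restrict (Ioo x y))).NeBot := by
    rw [ae_neBot, Ne, Measure.restrict_eq_zero]
    simp [hxy]
  exact ((ae_restrict_mem measurableSet_Ioo).and h').exists

theorem toReal_le_of_le_ofReal_mul {x y : ENNReal} {c : ℝ} (hc : 0 ≤ c) (hy : y ≠ ⊤)
    (h : x ≤ ENNReal.ofReal c * y) : x.toReal ≤ c * y.toReal := by
  simpa [ENNReal.toReal_mul, ENNReal.toReal_ofReal hc] using
    ENNReal.toReal_mono (ENNReal.mul_ne_top ENNReal.ofReal_ne_top hy) h

/-- A positive monotone function with subpolynomial dilation growth is slowly varying as soon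
as it is finite. -/
theorem Monotone.slowlyVarying_toReal_iff {F : ℝ → ENNReal} (hF : Monotone F)
    (hpos : ∀ t, 0 < t → F t ≠ 0)
    (hup : ∀ ε : ℝ, 0 < ε → ∃ C : ℝ, 0 < C ∧ ∀ l : ℝ, 1 ≤ l → ∀ u : ℝ, 0 < u →
      F (l * u) ≤ ENNReal.ofReal (C * l ^ ε) * F u) :
    SlowlyVarying (fun t => (F t).toReal) ↔
      ∀ᵐ t ∂(volume.restrict (Ioi (0 : ℝ))), F t < ⊤ := by
  refine ⟨ae_lt_top_of_slowlyVarying_toReal, fun h => ?_⟩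
  have hfin : ∀ t, 0 < t → F t ≠ ⊤ := fun t ht => by
    obtain ⟨s, hs, hs'⟩ := exists_mem_Ioo_of_ae_restrict h (lt_add_one t)
      (fun x hx => ht.trans hx.1)
    exact ((hF hs.1.le).trans_lt hs').ne
  refine slowlyVarying_of_dilation_bounds hF.measurable.ennreal_toReal
    (fun t ht => ENNReal.toReal_pos (hpos t ht) (hfin t ht)) (fun ε hε => ?_)
    (fun ε hε => ⟨1, fun l hl u hu => ?_⟩)
  · obtain ⟨C, hC, hCF⟩ := hup ε hε
    exact ⟨C, fun l hl u hu =>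
      toReal_le_of_le_ofReal_mul (by positivity) (hfin u hu) (hCF l hl u hu)⟩
  · rw [one_mul]
    calc (F u).toReal ≤ (F (l * u)).toReal :=
          ENNReal.toReal_mono (hfin _ (by positivity)) (hF (le_mul_of_one_le_left hu.le hl))
      _ ≤ _ := le_mul_of_one_le_left ENNReal.toReal_nonneg (Real.one_le_rpow hl hε.le)

/-- A positive antitone function with subpolynomial dilation decay is slowly varying as soon
as it is finite. -/
theorem Antitone.slowlyVarying_toReal_iff {F : ℝ → ENNReal} (hF : Antitone F)
    (hpos : ∀ t, 0 < t → F t ≠ 0)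
    (hdown : ∀ ε : ℝ, 0 < ε → ∃ C : ℝ, 0 < C ∧ ∀ l : ℝ, 1 ≤ l → ∀ u : ℝ, 0 < u →
      F u ≤ ENNReal.ofReal (C * l ^ ε) * F (l * u)) :
    SlowlyVarying (fun t => (F t).toReal) ↔
      ∀ᵐ t ∂(volume.restrict (Ioi (0 : ℝ))), F t < ⊤ := by
  refine ⟨ae_lt_top_of_slowlyVarying_toReal, fun h => ?_⟩
  have hfin : ∀ t, 0 < t → F t ≠ ⊤ := fun t ht => by
    obtain ⟨s, hs, hs'⟩ := exists_mem_Ioo_of_ae_restrict h ht (fun x hx => hx.1)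
    exact ((hF hs.2.le).trans_lt hs').ne
  refine slowlyVarying_of_dilation_bounds hF.measurable.ennreal_toReal
    (fun t ht => ENNReal.toReal_pos (hpos t ht) (hfin t ht))
    (fun ε hε => ⟨1, fun l hl u hu => ?_⟩) (fun ε hε => ?_)
  · rw [one_mul]
    calc (F (l * u)).toReal ≤ (F u).toReal :=
          ENNReal.toReal_mono (hfin u hu) (hF (le_mul_of_one_le_left hu.le hl))
      _ ≤ _ := le_mul_of_one_le_left ENNReal.toReal_nonneg (Real.one_le_rpow hl hε.le)
  · obtain ⟨C, hC, hCF⟩ := hdown ε hε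
    exact ⟨C, fun l hl u hu =>
      toReal_le_of_le_ofReal_mul (by positivity) (hfin _ (by positivity)) (hCF l hl u hu)⟩

theorem volume_restrict_eq_smul_map_mul_left {l : ℝ} (hl : 0 < l) (S : Set ℝ) :
    volume.restrict S =
      ENNReal.ofReal l • (volume.restrict ((l * ·) ⁻¹' S)).map (l * ·) := by
  have he : MeasurableEmbedding (fun x : ℝ => l * x) := measurableEmbedding_mulLeft₀ hl.ne'
  rw [← he.restrict_map, Real.map_volume_mul_left hl.ne', Measure.restrict_smul, smul_smul,
    ← ENNReal.ofReal_mul hl.le, abs_of_pos (inv_pos.2 hl), mul_inv_cancel₀ hl.ne',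
    ENNReal.ofReal_one, one_smul]

theorem setLIntegral_inv_mul_dilation {b : ℝ → ℝ} (hb : Measurable b) {l : ℝ} (hl : 0 < l)
    (S : Set ℝ) :
    ∫⁻ s in S, ENNReal.ofReal (s⁻¹ * b s) =
      ∫⁻ s in (l * ·) ⁻¹' S, ENNReal.ofReal (s⁻¹ * b (l * s)) := by
  conv_lhs => rw [volume_restrict_eq_smul_map_mul_left hl S]
  rw [lintegral_smul_measure, lintegral_map (by fun_prop) (by fun_prop), smul_eq_mul,
    ← lintegral_const_mul _ (by fun_prop)]
  congr 1
  ext s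
  rw [← ENNReal.ofReal_mul hl.le, mul_inv]
  congr 1
  field_simp

theorem essSup_restrict_dilation {b : ℝ → ℝ} (hb : Measurable b) {l : ℝ} (hl : 0 < l)
    (S : Set ℝ) :
    essSup (fun s => ENNReal.ofReal (b s)) (volume.restrict S) =
      essSup (fun s => ENNReal.ofReal (b (l * s))) (volume.restrict ((l * ·) ⁻¹' S)) := by
  conv_lhs => rw [volume_restrict_eq_smul_map_mul_left hl S]
  rw [essSup_ennreal_smul_measure (by simpa using hl),
    essSup_map_measure (by fun_prop) (by fun_prop)]
  rfl

theorem setLIntegral_inv_mul_le {f g : ℝ → ℝ} {S : Set ℝ} (hS : MeasurableSet S)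
    (hSpos : S ⊆ Ioi 0) (hg : Measurable g) {K : ℝ} (hK : 0 ≤ K)
    (h : ∀ u, 0 < u → f u ≤ K * g u) :
    ∫⁻ s in S, ENNReal.ofReal (s⁻¹ * f s) ≤
      ENNReal.ofReal K * ∫⁻ s in S, ENNReal.ofReal (s⁻¹ * g s) := by
  rw [← lintegral_const_mul _ (by fun_prop)]
  refine setLIntegral_mono' hS fun s hs => ?_
  rw [← ENNReal.ofReal_mul hK]
  have hs0 : 0 < s := hSpos hs
  refine ENNReal.ofReal_le_ofReal ?_
  calc s⁻¹ * f s ≤ s⁻¹ * (K * g s) := by have := h s hs0; gcongr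
    _ = _ := by ring

theorem essSup_restrict_le {f g : ℝ → ℝ} {S : Set ℝ} (hS : MeasurableSet S)
    (hSpos : S ⊆ Ioi 0) {K : ℝ} (hK : 0 ≤ K) (h : ∀ u, 0 < u → f u ≤ K * g u) :
    essSup (fun s => ENNReal.ofReal (f s)) (volume.restrict S) ≤
      ENNReal.ofReal K * essSup (fun s => ENNReal.ofReal (g s)) (volume.restrict S) := by
  refine essSup_le_of_ae_le _ ?_
  filter_upwards [ENNReal.ae_le_essSup (μ := volume.restrict S) fun s => ENNReal.ofReal (g s),
    ae_restrict_mem hS] with s hs hsS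
  calc ENNReal.ofReal (f s) ≤ ENNReal.ofReal (K * g s) :=
        ENNReal.ofReal_le_ofReal (h s (hSpos hsS))
    _ = ENNReal.ofReal K * ENNReal.ofReal (g s) := ENNReal.ofReal_mul hK
    _ ≤ _ := by gcongr

theorem monotone_tildeB (b : ℝ → ℝ) : Monotone (tildeB b) := fun _ _ h =>
  lintegral_mono_set (Ioc_subset_Ioc_right h)

theorem antitone_hatB (b : ℝ → ℝ) : Antitone (hatB b) := fun _ _ h =>
  lintegral_mono_set (Ioi_subset_Ioi h)

theorem monotone_tildeBinf (b : ℝ → ℝ) : Monotone (tildeBinf b) := fun _ _ h =>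
  essSup_mono_measure
    (Measure.restrict_mono (Ioo_subset_Ioo_right h) le_rfl).absolutelyContinuous

theorem antitone_hatBinf (b : ℝ → ℝ) : Antitone (hatBinf b) := fun _ _ h =>
  essSup_mono_measure (Measure.restrict_mono (Ioi_subset_Ioi h) le_rfl).absolutelyContinuous

theorem SlowlyVarying.comparable_of_le_two_mul {b : ℝ → ℝ} (hb : SlowlyVarying b) :
    ∃ C : ℝ, 0 < C ∧ ∀ s t : ℝ, 0 < s → 0 < t → t ≤ 2 * s → s ≤ 2 * t → b t ≤ C * b s := by
  obtain ⟨C, hC, h⟩ := hb.dilation_bounds one_pos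
  refine ⟨C * 2, by positivity, fun s t hs ht hts hst => ?_⟩
  have hbs := hb.2.1 s hs
  have key : ∀ r : ℝ, r ≤ 2 → C * r ^ (1 : ℝ) * b s ≤ C * 2 * b s := fun r hr => by
    rw [Real.rpow_one]; gcongr
  rcases le_total s t with hle | hle
  · have := (h (t / s) ((one_le_div hs).2 hle) s hs).1
    rw [div_mul_cancel₀ _ hs.ne'] at this
    exact this.trans (key _ ((div_le_iff₀ hs).2 hts))
  · have := (h (s / t) ((one_le_div ht).2 hle) t ht).2
    rw [div_mul_cancel₀ _ ht.ne'] at this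
    exact this.trans (key _ ((div_le_iff₀ ht).2 hst))

theorem SlowlyVarying.le_setLIntegral {b : ℝ → ℝ} (hb : SlowlyVarying b) :
    ∃ C : ℝ, 0 < C ∧ ∀ x : ℝ, 0 < x → ∀ t ∈ Icc x (2 * x),
      ENNReal.ofReal (b t) ≤
        ENNReal.ofReal C * ∫⁻ s in Ioc x (2 * x), ENNReal.ofReal (s⁻¹ * b s) := by
  obtain ⟨C, hC, h⟩ := hb.comparable_of_le_two_mul
  refine ⟨2 * C, by positivity, fun x hx t ht => ?_⟩
  have ht0 : 0 < t := hx.trans_le ht.1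
  have hbt := hb.2.1 t ht0
  have hmain : ENNReal.ofReal ((2 * x)⁻¹ * (C⁻¹ * b t)) * ENNReal.ofReal x ≤
      ∫⁻ s in Ioc x (2 * x), ENNReal.ofReal (s⁻¹ * b s) := by
    calc _ = ∫⁻ _ in Ioc x (2 * x), ENNReal.ofReal ((2 * x)⁻¹ * (C⁻¹ * b t)) := by
          rw [setLIntegral_const, Real.volume_Ioc]
          congr 2
          ring
      _ ≤ _ := setLIntegral_mono' measurableSet_Ioc fun s hs => by
          have hs0 : 0 < s := hx.trans hs.1
          have h1 : C⁻¹ * b t ≤ b s := (inv_mul_le_iff₀ hC).2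
            (h s t hs0 ht0 (by linarith [ht.2, hs.1]) (by linarith [ht.1, hs.2]))
          have h2 : (2 * x)⁻¹ ≤ s⁻¹ := inv_anti₀ hs0 hs.2
          refine ENNReal.ofReal_le_ofReal ?_
          gcongr
  calc ENNReal.ofReal (b t)
      = ENNReal.ofReal (2 * C) * (ENNReal.ofReal ((2 * x)⁻¹ * (C⁻¹ * b t)) * ENNReal.ofReal x) := by
        rw [← ENNReal.ofReal_mul (by positivity), ← ENNReal.ofReal_mul (by positivity)]
        congr 1
        field_simp
    _ ≤ _ := by gcongr

theorem SlowlyVarying.le_essSup {b : ℝ → ℝ} (hb : SlowlyVarying b) :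
    ∃ C : ℝ, 0 < C ∧ ∀ x : ℝ, 0 < x → ∀ t ∈ Icc x (2 * x), ∀ S : Set ℝ, Ioo x (2 * x) ⊆ S →
      ENNReal.ofReal (b t) ≤
        ENNReal.ofReal C * essSup (fun s => ENNReal.ofReal (b s)) (volume.restrict S) := by
  obtain ⟨C, hC, h⟩ := hb.comparable_of_le_two_mul
  refine ⟨C, hC, fun x hx t ht S hS => ?_⟩
  obtain ⟨s, hs, hs'⟩ := exists_mem_Ioo_of_ae_restrict
    (ENNReal.ae_le_essSup (μ := volume.restrict S) fun s => ENNReal.ofReal (b s))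
    (by linarith : x < 2 * x) hS
  calc ENNReal.ofReal (b t) ≤ ENNReal.ofReal (C * b s) := ENNReal.ofReal_le_ofReal
        (h s t (hx.trans hs.1) (hx.trans_le ht.1) (by linarith [ht.2, hs.1])
          (by linarith [ht.1, hs.2]))
    _ = ENNReal.ofReal C * ENNReal.ofReal (b s) := ENNReal.ofReal_mul hC.le
    _ ≤ _ := by gcongr

theorem ne_zero_of_ofReal_le_mul {F : ℝ → ENNReal} {b : ℝ → ℝ}
    (hb : ∀ t ∈ Ioi (0 : ℝ), 0 < b t)
    (h : ∃ C : ℝ, 0 < C ∧ ∀ t ∈ Ioi (0 : ℝ), ENNReal.ofReal (b t) ≤ ENNReal.ofReal C * F t)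
    (t : ℝ) (ht : 0 < t) : F t ≠ 0 := by
  obtain ⟨C, -, hC⟩ := h
  intro h0
  have := hC t ht
  rw [h0, mul_zero, nonpos_iff_eq_zero, ENNReal.ofReal_eq_zero] at this
  exact this.not_gt (hb t ht)

/-- `b ≲ b̃`, `b ≲ b̃_∞`, `b ≲ b̂`, `b ≲ b̂_∞` on `(0,∞)`, and each of `b̃`, `b̃_∞`,
`b̂`, `b̂_∞` is slowly varying if and only if it is finite a.e. on `(0,∞)`. -/
theorem slowlyVarying_tilde_hat (b : ℝ → ℝ) (hb : SlowlyVarying b) :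
    (∃ C : ℝ, 0 < C ∧ ∀ t ∈ Ioi (0:ℝ),
      ENNReal.ofReal (b t) ≤ ENNReal.ofReal C * tildeB b t) ∧
    (∃ C : ℝ, 0 < C ∧ ∀ t ∈ Ioi (0:ℝ),
      ENNReal.ofReal (b t) ≤ ENNReal.ofReal C * tildeBinf b t) ∧
    (∃ C : ℝ, 0 < C ∧ ∀ t ∈ Ioi (0:ℝ),
      ENNReal.ofReal (b t) ≤ ENNReal.ofReal C * hatB b t) ∧
    (∃ C : ℝ, 0 < C ∧ ∀ t ∈ Ioi (0:ℝ),
      ENNReal.ofReal (b t) ≤ ENNReal.ofReal C * hatBinf b t) ∧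
    (SlowlyVarying (fun t => (tildeB b t).toReal) ↔
      ∀ᵐ t ∂(volume.restrict (Ioi (0:ℝ))), tildeB b t < ⊤) ∧
    (SlowlyVarying (fun t => (tildeBinf b t).toReal) ↔
      ∀ᵐ t ∂(volume.restrict (Ioi (0:ℝ))), tildeBinf b t < ⊤) ∧
    (SlowlyVarying (fun t => (hatB b t).toReal) ↔
      ∀ᵐ t ∂(volume.restrict (Ioi (0:ℝ))), hatB b t < ⊤) ∧
    (SlowlyVarying (fun t => (hatBinf b t).toReal) ↔
      ∀ᵐ t ∂(volume.restrict (Ioi (0:ℝ))), hatBinf b t < ⊤) := by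
  have hpos := hb.2.1
  have hmeas := hb.1
  have h1 : ∃ C : ℝ, 0 < C ∧ ∀ t ∈ Ioi (0:ℝ),
      ENNReal.ofReal (b t) ≤ ENNReal.ofReal C * tildeB b t := by
    obtain ⟨C, hC, h⟩ := hb.le_setLIntegral
    refine ⟨C, hC, fun t (ht : 0 < t) =>
      (h (t / 2) (by positivity) t ⟨by linarith, by linarith⟩).trans ?_⟩
    gcongr
    exact lintegral_mono_set (Ioc_subset_Ioc (by positivity) (by linarith))
  have h2 : ∃ C : ℝ, 0 < C ∧ ∀ t ∈ Ioi (0:ℝ),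
      ENNReal.ofReal (b t) ≤ ENNReal.ofReal C * tildeBinf b t := by
    obtain ⟨C, hC, h⟩ := hb.le_essSup
    exact ⟨C, hC, fun t (ht : 0 < t) =>
      h (t / 2) (by positivity) t ⟨by linarith, by linarith⟩ _
        (Ioo_subset_Ioo (by positivity) (by linarith))⟩
  have h3 : ∃ C : ℝ, 0 < C ∧ ∀ t ∈ Ioi (0:ℝ),
      ENNReal.ofReal (b t) ≤ ENNReal.ofReal C * hatB b t := by
    obtain ⟨C, hC, h⟩ := hb.le_setLIntegral
    refine ⟨C, hC, fun t (ht : 0 < t) => (h t ht t ⟨le_rfl, by linarith⟩).trans ?_⟩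
    gcongr
    exact lintegral_mono_set Ioc_subset_Ioi_self
  have h4 : ∃ C : ℝ, 0 < C ∧ ∀ t ∈ Ioi (0:ℝ),
      ENNReal.ofReal (b t) ≤ ENNReal.ofReal C * hatBinf b t := by
    obtain ⟨C, hC, h⟩ := hb.le_essSup
    exact ⟨C, hC, fun t (ht : 0 < t) => h t ht t ⟨le_rfl, by linarith⟩ _ Ioo_subset_Ioi_self⟩
  refine ⟨h1, h2, h3, h4,
    (monotone_tildeB b).slowlyVarying_toReal_iff (ne_zero_of_ofReal_le_mul hpos h1) ?_,
    (monotone_tildeBinf b).slowlyVarying_toReal_iff (ne_zero_of_ofReal_le_mul hpos h2) ?_,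
    (antitone_hatB b).slowlyVarying_toReal_iff (ne_zero_of_ofReal_le_mul hpos h3) ?_,
    (antitone_hatBinf b).slowlyVarying_toReal_iff (ne_zero_of_ofReal_le_mul hpos h4) ?_⟩
  all_goals
    intro ε hε
    obtain ⟨C, hC, h⟩ := hb.dilation_bounds hε
    refine ⟨C, hC, fun l hl u hu => ?_⟩
    have hl0 : 0 < l := one_pos.trans_le hl
    have hK : 0 ≤ C * l ^ ε := by positivity
  · have hpre : (l * ·) ⁻¹' Ioc 0 (l * u) = Ioc 0 u := by
      ext; simp [hl0, hl0.ne']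
    rw [tildeB, setLIntegral_inv_mul_dilation hmeas hl0, hpre]
    exact setLIntegral_inv_mul_le measurableSet_Ioc Ioc_subset_Ioi_self hmeas hK
      fun s hs => (h l hl s hs).1
  · have hpre : (l * ·) ⁻¹' Ioo 0 (l * u) = Ioo 0 u := by
      ext; simp [hl0, hl0.ne']
    rw [tildeBinf, essSup_restrict_dilation hmeas hl0, hpre]
    exact essSup_restrict_le measurableSet_Ioo Ioo_subset_Ioi_self hK
      fun s hs => (h l hl s hs).1
  · have hpre : (l * ·) ⁻¹' Ioi (l * u) = Ioi u := by
      ext; simp [hl0, hl0.ne']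
    rw [hatB, hatB, setLIntegral_inv_mul_dilation hmeas hl0 (Ioi (l * u)), hpre]
    exact setLIntegral_inv_mul_le measurableSet_Ioi (Ioi_subset_Ioi hu.le) (by fun_prop) hK
      fun s hs => (h l hl s hs).2
  · have hpre : (l * ·) ⁻¹' Ioi (l * u) = Ioi u := by
      ext; simp [hl0, hl0.ne']
    rw [hatBinf, hatBinf, essSup_restrict_dilation hmeas hl0 (Ioi (l * u)), hpre]
    exact essSup_restrict_le measurableSet_Ioi (Ioi_subset_Ioi hu.le) hK
      fun s hs => (h l hl s hs).2
end
end

section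
/- Let b be a slowly varying function such that b̃(t) = ∫₀^t s^{-1} b(s) ds and b̂(t) = ∫_t^∞ s^{-1} b(s) ds are finite for every t ∈ (0,∞). Then limsup_{t → 0⁺} b̃(t)/b(t) = ∞, limsup_{t → ∞} b̃(t)/b(t) = ∞, limsup_{t → 0⁺} b̂(t)/b(t) = ∞, and limsup_{t → ∞} b̂(t)/b(t) = ∞. -/
open MeasureTheory Set Filter Topology

noncomputable section

/-- `β` stands for a slowly varying function in the logarithmic variable and `φ` for a positive
bounded increasing primitive of it, known only through lower bounds of its increments. -/
structure LogPrimitive (β φ : ℝ → ℝ) : Prop where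
  pos : ∀ u, 0 < β u
  growth : ∀ ε : ℝ, 0 < ε → ∃ K : ℝ, 0 < K ∧ ∀ u v, K * Real.exp (-(ε * |u - v|)) * β v ≤ β u
  mono : Monotone φ
  nonneg : ∀ u, 0 ≤ φ u
  bounded : ∃ T, ∀ u, φ u ≤ T
  increment : ∀ u m, (∀ v ∈ Icc u (u + 1), m ≤ β v) → φ u + m ≤ φ (u + 1)

namespace LogPrimitive

variable {β φ : ℝ → ℝ}

theorem exists_lower_bound (h : LogPrimitive β φ) {ε : ℝ} (hε : 0 < ε) (U : ℝ) :
    ∃ c : ℝ, 0 < c ∧ ∀ u ≤ U, c * Real.exp (-(ε * (U - u))) ≤ φ u := by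
  obtain ⟨K, hK, hgrowth⟩ := h.growth ε hε
  refine ⟨K * Real.exp (-ε) * β U, by have := h.pos U; positivity, fun u hu => ?_⟩
  have hinc := h.increment (u - 1) (K * Real.exp (-ε) * β U * Real.exp (-(ε * (U - u)))) ?_
  · rw [sub_add_cancel] at hinc
    linarith [h.nonneg (u - 1)]
  · rintro v ⟨hv₁, hv₂⟩
    refine le_trans ?_ (hgrowth v U)
    have hexp : Real.exp (-ε) * Real.exp (-(ε * (U - u))) ≤ Real.exp (-(ε * |v - U|)) := by
      rw [← Real.exp_add, Real.exp_le_exp, abs_sub_comm, abs_of_nonneg (by linarith)]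
      nlinarith
    have hβ := h.pos U
    calc K * Real.exp (-ε) * β U * Real.exp (-(ε * (U - u)))
        = K * (Real.exp (-ε) * Real.exp (-(ε * (U - u)))) * β U := by ring
      _ ≤ K * Real.exp (-(ε * |v - U|)) * β U := by gcongr

theorem primitive_pos (h : LogPrimitive β φ) (u : ℝ) : 0 < φ u := by
  obtain ⟨c, hc, hφ⟩ := h.exists_lower_bound one_pos u
  exact lt_of_lt_of_le (by positivity) (hφ u le_rfl)

theorem bound_pos (h : LogPrimitive β φ) {M u : ℝ} (hM : φ u ≤ M * β u) : 0 < M :=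
  pos_of_mul_pos_left ((h.primitive_pos u).trans_le hM) (h.pos u).le

theorem frequently_atTop (h : LogPrimitive β φ) (M : ℝ) : ∃ᶠ u in atTop, M * β u < φ u := by
  intro hev
  obtain ⟨U, hU⟩ := eventually_atTop.1 hev
  simp only [not_lt] at hU
  have hM := h.bound_pos (hU U le_rfl)
  have hm : 0 < φ U / M := div_pos (h.primitive_pos U) hM
  have hgrow : ∀ n : ℕ, n * (φ U / M) ≤ φ (U + n) := by
    intro n
    induction n with
    | zero => simpa using h.nonneg U
    | succ n ih =>
      have hinc := h.increment (U + n) (φ U / M) fun v hv => by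
        have hUv : U ≤ v := by linarith [hv.1, n.cast_nonneg (α := ℝ)]
        rw [div_le_iff₀' hM]
        exact (h.mono hUv).trans (hU v hUv)
      push_cast
      rw [← add_assoc]
      linarith
  obtain ⟨T, hT⟩ := h.bounded
  obtain ⟨n, hn⟩ := exists_nat_gt (T / (φ U / M))
  rw [div_lt_iff₀ hm] at hn
  linarith [hgrow n, hT (U + n)]

theorem frequently_atBot (h : LogPrimitive β φ) (M : ℝ) : ∃ᶠ u in atBot, M * β u < φ u := by
  intro hev
  obtain ⟨U, hU⟩ := eventually_atBot.1 hev
  simp only [not_lt] at hU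
  have hM := h.bound_pos (hU U le_rfl)
  set ε := Real.log (1 + 1 / M) / 2 with hε_def
  have hε : 0 < ε := half_pos (Real.log_pos (by linarith [one_div_pos.2 hM]))
  have hq : Real.exp (2 * ε) = 1 + 1 / M := by
    rw [hε_def, mul_div_cancel₀ _ two_ne_zero, Real.exp_log (by positivity)]
  have hdecay : ∀ n : ℕ, Real.exp (2 * ε * n) * φ (U - n) ≤ φ U := by
    intro n
    induction n with
    | zero => simp
    | succ n ih =>
      have hinc := h.increment (U - (n + 1)) (φ (U - (n + 1)) / M) fun v hv => by
        rw [div_le_iff₀' hM]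
        exact (h.mono hv.1).trans (hU v (by linarith [hv.2, n.cast_nonneg (α := ℝ)]))
      rw [show U - ((n : ℝ) + 1) + 1 = U - n by ring] at hinc
      push_cast
      calc Real.exp (2 * ε * (n + 1)) * φ (U - (n + 1))
          = Real.exp (2 * ε * n) * (φ (U - (n + 1)) + φ (U - (n + 1)) / M) := by
            rw [mul_add, Real.exp_add, mul_one, hq]; ring
        _ ≤ Real.exp (2 * ε * n) * φ (U - n) := by gcongr
        _ ≤ φ U := ih
  obtain ⟨c, hc, hφ⟩ := h.exists_lower_bound hε U
  have hbdd : ∀ n : ℕ, c * (ε * n) ≤ φ U := by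
    intro n
    have hlow := hφ (U - n) (by linarith [n.cast_nonneg (α := ℝ)])
    rw [sub_sub_cancel] at hlow
    calc c * (ε * n) ≤ c * Real.exp (ε * n) := by
          gcongr
          linarith [Real.add_one_le_exp (ε * n)]
      _ = Real.exp (2 * ε * n) * (c * Real.exp (-(ε * n))) := by
          rw [mul_left_comm, ← Real.exp_add]; ring_nf
      _ ≤ Real.exp (2 * ε * n) * φ (U - n) := by gcongr
      _ ≤ φ U := hdecay n
  obtain ⟨n, hn⟩ := exists_nat_gt (φ U / (c * ε))
  rw [div_lt_iff₀ (by positivity)] at hn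
  linarith [hbdd n]

end LogPrimitive

theorem SlowlyVarying.exp_growth {b : ℝ → ℝ} (hb : SlowlyVarying b) {ε : ℝ} (hε : 0 < ε) :
    ∃ K : ℝ, 0 < K ∧ ∀ u v : ℝ,
      K * Real.exp (-(ε * |u - v|)) * b (Real.exp v) ≤ b (Real.exp u) := by
  obtain ⟨bp, bm, hbp, hbm, hbp₀, hbm₀, ⟨C₁, C₂, hC₁, hC, hp⟩, ⟨D₁, D₂, hD₁, hD, hm⟩⟩ := hb.2.2 ε hε
  have hC₂ := hC₁.trans_le hC
  have hD₂ := hD₁.trans_le hD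
  refine ⟨min (C₁ / C₂) (D₁ / D₂), by positivity, fun u v => ?_⟩
  have hbv := hb.2.1 _ (Real.exp_pos v)
  have hpow : ∀ a w : ℝ, Real.exp w ^ a = Real.exp (w * a) := fun a w => (Real.exp_mul w a).symm
  -- A comparison of weighted values at `v` and `u` divides out to the required estimate.
  have key : ∀ a A B x y : ℝ, 0 < A → 0 < B → x ≤ y → a * (v - u) = -(ε * |u - v|) →
      Real.exp (v * a) * b (Real.exp v) ≤ B * x → A * y ≤ Real.exp (u * a) * b (Real.exp u) →
      A / B * Real.exp (-(ε * |u - v|)) * b (Real.exp v) ≤ b (Real.exp u) := by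
    intro a A B x y hA hB hxy ha hv hu
    rw [← ha]
    have hsplit : Real.exp (v * a) = Real.exp (u * a) * Real.exp (a * (v - u)) := by
      rw [← Real.exp_add]; ring_nf
    refine le_of_mul_le_mul_left ?_ (Real.exp_pos (u * a))
    calc Real.exp (u * a) * (A / B * Real.exp (a * (v - u)) * b (Real.exp v))
        = A / B * (Real.exp (v * a) * b (Real.exp v)) := by rw [hsplit]; ring
      _ ≤ A / B * (B * x) := by gcongr
      _ = A * x := by field_simp
      _ ≤ A * y := by gcongr
      _ ≤ _ := hu
  rcases le_total v u with huv | huv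
  · have h := key ε C₁ C₂ _ _ hC₁ hC₂ (hbp (Real.exp_pos v) (Real.exp_pos u) (Real.exp_le_exp.2 huv))
      (by rw [abs_of_nonneg (sub_nonneg.2 huv)]; ring)
      (by simpa only [hpow] using (hp _ (Real.exp_pos v)).2)
      (by simpa only [hpow] using (hp _ (Real.exp_pos u)).1)
    refine le_trans ?_ h
    gcongr
    exact min_le_left _ _
  · have h := key (-ε) D₁ D₂ _ _ hD₁ hD₂
      (hbm (Real.exp_pos u) (Real.exp_pos v) (Real.exp_le_exp.2 huv))
      (by rw [abs_of_nonpos (sub_nonpos.2 huv)]; ring)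
      (by simpa only [hpow] using (hm _ (Real.exp_pos v)).2)
      (by simpa only [hpow] using (hm _ (Real.exp_pos u)).1)
    refine le_trans ?_ h
    gcongr
    exact min_le_right _ _

theorem le_setIntegral_inv_mul_exp {b : ℝ → ℝ} {u m : ℝ}
    (hint : IntegrableOn (fun s => s⁻¹ * b s) (Ioc (Real.exp u) (Real.exp (u + 1))))
    (hm : ∀ v ∈ Icc u (u + 1), m ≤ b (Real.exp v)) :
    m ≤ ∫ s in Ioc (Real.exp u) (Real.exp (u + 1)), s⁻¹ * b s := by
  have hle : Real.exp u ≤ Real.exp (u + 1) := Real.exp_le_exp.2 (by linarith)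
  have hone : ∫ s in Ioc (Real.exp u) (Real.exp (u + 1)), s⁻¹ = 1 := by
    rw [← intervalIntegral.integral_of_le hle,
      integral_inv_of_pos (Real.exp_pos _) (Real.exp_pos _), ← Real.exp_sub, Real.log_exp]
    ring
  have hinv : IntegrableOn (fun s : ℝ => s⁻¹) (Ioc (Real.exp u) (Real.exp (u + 1))) :=
    Integrable.of_integral_ne_zero (by rw [hone]; exact one_ne_zero)
  calc m = ∫ s in Ioc (Real.exp u) (Real.exp (u + 1)), s⁻¹ * m := by
        rw [integral_mul_const, hone, one_mul]
    _ ≤ _ := by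
        refine setIntegral_mono_on (hinv.mul_const m) hint measurableSet_Ioc fun s hs => ?_
        have hs₀ : 0 < s := (Real.exp_pos u).trans hs.1
        have := hm (Real.log s) ⟨(Real.le_log_iff_exp_le hs₀).2 hs.1.le,
          (Real.log_le_iff_le_exp hs₀).2 hs.2⟩
        rw [Real.exp_log hs₀] at this
        gcongr

/-- If `b̃(t) = ∫₀^t s⁻¹ b(s) ds` and `b̂(t) = ∫_t^∞ s⁻¹ b(s) ds` are finite for every
`t ∈ (0,∞)`, then the limsups of `b̃/b` and of `b̂/b` at `0⁺` and at `∞` are all infinite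
(formulated as: every real bound is exceeded frequently). -/
theorem slowlyVarying_limsup_tilde_hat (b : ℝ → ℝ) (hb : SlowlyVarying b)
    (hfin₀ : ∀ t ∈ Ioi (0:ℝ), IntegrableOn (fun s => s⁻¹ * b s) (Ioc 0 t))
    (hfinTop : ∀ t ∈ Ioi (0:ℝ), IntegrableOn (fun s => s⁻¹ * b s) (Ioi t)) :
    (∀ M : ℝ, ∃ᶠ t in 𝓝[>] (0:ℝ), M < (∫ s in Ioc 0 t, s⁻¹ * b s) / b t) ∧
    (∀ M : ℝ, ∃ᶠ t in atTop, M < (∫ s in Ioc 0 t, s⁻¹ * b s) / b t) ∧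
    (∀ M : ℝ, ∃ᶠ t in 𝓝[>] (0:ℝ), M < (∫ s in Ioi t, s⁻¹ * b s) / b t) ∧
    (∀ M : ℝ, ∃ᶠ t in atTop, M < (∫ s in Ioi t, s⁻¹ * b s) / b t) := by
  have hpos : ∀ s ∈ Ioi (0 : ℝ), 0 ≤ s⁻¹ * b s := fun s hs =>
    mul_nonneg (inv_nonneg.2 (mem_Ioi.1 hs).le) (hb.2.1 s hs).le
  have hall : IntegrableOn (fun s => s⁻¹ * b s) (Ioi 0) := by
    rw [← Ioc_union_Ioi_eq_Ioi zero_le_one]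
    exact (hfin₀ 1 (mem_Ioi.2 one_pos)).union (hfinTop 1 (mem_Ioi.2 one_pos))
  have hnonneg : ∀ S ⊆ Ioi (0 : ℝ), MeasurableSet S → 0 ≤ ∫ s in S, s⁻¹ * b s := fun S hS hS' =>
    setIntegral_nonneg hS' fun s hs => hpos s (hS hs)
  have hmono : ∀ S S' : Set ℝ, S ⊆ S' → S' ⊆ Ioi 0 → MeasurableSet S' →
      ∫ s in S, s⁻¹ * b s ≤ ∫ s in S', s⁻¹ * b s := fun S S' h h' hS' =>
    setIntegral_mono_set (hall.mono_set h')
      ((ae_restrict_iff' hS').2 (.of_forall fun s hs => hpos s (h' hs))) h.eventuallyLE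
  have hIoc : ∀ u : ℝ, Ioc 0 (Real.exp u) ⊆ Ioi 0 := fun u => Ioc_subset_Ioi_self
  have hIoi : ∀ u : ℝ, Ioi (Real.exp u) ⊆ Ioi 0 := fun u => Ioi_subset_Ioi (Real.exp_pos u).le
  have hstep : ∀ u : ℝ, Ioc (Real.exp u) (Real.exp (u + 1)) ⊆ Ioi 0 := fun u =>
    Ioc_subset_Ioi_self.trans (hIoi u)
  have hlt : ∀ u : ℝ, Real.exp u ≤ Real.exp (u + 1) := fun u => Real.exp_le_exp.2 (by linarith)
  have htilde : LogPrimitive (fun u => b (Real.exp u))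
      (fun u => ∫ s in Ioc 0 (Real.exp u), s⁻¹ * b s) :=
    { pos := fun u => hb.2.1 _ (Real.exp_pos u)
      growth := fun ε hε => hb.exp_growth hε
      mono := fun u v huv =>
        hmono _ _ (Ioc_subset_Ioc_right (Real.exp_le_exp.2 huv)) (hIoc v) measurableSet_Ioc
      nonneg := fun u => hnonneg _ (hIoc u) measurableSet_Ioc
      bounded := ⟨_, fun u => hmono _ _ (hIoc u) Subset.rfl measurableSet_Ioi⟩
      increment := fun u m hm => by
        have h := le_setIntegral_inv_mul_exp (hall.mono_set (hstep u)) hm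
        rw [← Ioc_union_Ioc_eq_Ioc (Real.exp_pos u).le (hlt u),
          setIntegral_union (Ioc_disjoint_Ioc_of_le le_rfl) measurableSet_Ioc
            (hall.mono_set (hIoc u)) (hall.mono_set (hstep u))]
        linarith }
  have hhat : LogPrimitive (fun u => b (Real.exp (-u)))
      (fun u => ∫ s in Ioi (Real.exp (-u)), s⁻¹ * b s) :=
    { pos := fun u => hb.2.1 _ (Real.exp_pos _)
      growth := fun ε hε => by
        obtain ⟨K, hK, h⟩ := hb.exp_growth hε
        refine ⟨K, hK, fun u v => ?_⟩
        have := h (-u) (-v)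
        rwa [neg_sub_neg, abs_sub_comm] at this
      mono := fun u v huv =>
        hmono _ _ (Ioi_subset_Ioi (Real.exp_le_exp.2 (neg_le_neg huv))) (hIoi _) measurableSet_Ioi
      nonneg := fun u => hnonneg _ (hIoi _) measurableSet_Ioi
      bounded := ⟨_, fun u => hmono _ _ (hIoi _) Subset.rfl measurableSet_Ioi⟩
      increment := fun u m hm => by
        have h := le_setIntegral_inv_mul_exp (hall.mono_set (hstep (-(u + 1)))) (m := m)
          fun v hv => by
            have := hm (-v) ⟨by linarith [hv.2], by linarith [hv.1]⟩
            rwa [neg_neg] at this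
        have hle := hlt (-(u + 1))
        rw [show -(u + 1) + 1 = -u by ring] at h hle
        have hsub := hstep (-(u + 1))
        rw [show -(u + 1) + 1 = -u by ring] at hsub
        rw [← Ioc_union_Ioi_eq_Ioi hle,
          setIntegral_union (Ioc_disjoint_Ioi le_rfl) measurableSet_Ioi
            (hall.mono_set hsub) (hall.mono_set (hIoi _))]
        linarith }
  have hdiv : ∀ (M : ℝ) (F : ℝ → ℝ) (u : ℝ), M * b (Real.exp u) < F (Real.exp u) →
      M < F (Real.exp u) / b (Real.exp u) := fun M F u h =>
    (lt_div_iff₀ (hb.2.1 _ (Real.exp_pos u))).2 h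
  refine ⟨fun M => ?_, fun M => ?_, fun M => ?_, fun M => ?_⟩
  · exact Real.tendsto_exp_atBot_nhdsGT.frequently ((htilde.frequently_atBot M).mono fun u hu =>
      hdiv M (fun t => ∫ s in Ioc 0 t, s⁻¹ * b s) u hu)
  · exact Real.tendsto_exp_atTop.frequently ((htilde.frequently_atTop M).mono fun u hu =>
      hdiv M (fun t => ∫ s in Ioc 0 t, s⁻¹ * b s) u hu)
  · exact (Real.tendsto_exp_atBot_nhdsGT.comp tendsto_neg_atTop_atBot).frequently
      ((hhat.frequently_atTop M).mono fun u hu =>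
        hdiv M (fun t => ∫ s in Ioi t, s⁻¹ * b s) (-u) hu)
  · exact (Real.tendsto_exp_atTop.comp tendsto_neg_atBot_atTop).frequently
      ((hhat.frequently_atBot M).mono fun u hu =>
        hdiv M (fun t => ∫ s in Ioi t, s⁻¹ * b s) (-u) hu)
end
end

section
/- Let b be a slowly varying function such that L = lim_{t → 0⁺} b(t) exists and L ∈ (0,∞), and extend b to all of ℝ by setting b(s) = L for s ∈ (-∞, 0]. Then for every t₀ > 0 there is a constant C > 0 such that for every t₁ ∈ [-t₀, t₀] and every t ∈ (0,∞), C^{-1} ≤ b(t - t₁)/b(t) ≤ C. In particular, for any t₁ ∈ ℝ the function t ↦ b(t - t₁) restricted to (0,∞) is slowly varying. -/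
open MeasureTheory Set Filter Topology

noncomputable section

/-- A slowly varying function on `(0,∞)` changes
by at most a multiple of `t / s` between `s` and `t`. -/
lemma SlowlyVarying.exists_ratio_bound {b : ℝ → ℝ} (hb : SlowlyVarying b) :
    ∃ K : ℝ, 0 < K ∧ ∀ s t : ℝ, 0 < s → s ≤ t →
      s * b s ≤ K * (t * b t) ∧ s * b t ≤ K * (t * b s) := by
  obtain ⟨-, hpos, h⟩ := hb
  obtain ⟨bp, bm, hmono, hanti, -, -, ⟨c₁, c₂, hc₁, hc, hp⟩, ⟨d₁, d₂, hd₁, hd, hm⟩⟩ := h 1 one_pos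
  have hc₂ : 0 < c₂ := hc₁.trans_le hc
  have hd₂ : 0 < d₂ := hd₁.trans_le hd
  refine ⟨c₂ / c₁ + d₂ / d₁, by positivity, fun s t hs hst => ?_⟩
  have ht : 0 < t := hs.trans_le hst
  have hbs := hpos s hs
  have hbt := hpos t ht
  have hp' := hmono hs ht hst
  have hm' := hanti hs ht hst
  have hps := (hp s hs).2
  have hpt := (hp t ht).1
  have hms := (hm s hs).1
  have hmt := (hm t ht).2
  simp only [Real.rpow_one, Real.rpow_neg_one] at hps hpt hms hmt
  constructor
  · have key : s * b s ≤ c₂ / c₁ * (t * b t) := calc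
      s * b s ≤ c₂ * bp s := hps
      _ ≤ c₂ * bp t := by gcongr
      _ = c₂ / c₁ * (c₁ * bp t) := by field_simp
      _ ≤ c₂ / c₁ * (t * b t) := by gcongr
    refine key.trans ?_
    gcongr
    exact le_add_of_nonneg_right (by positivity)
  · have key : t⁻¹ * b t ≤ d₂ / d₁ * (s⁻¹ * b s) := calc
      t⁻¹ * b t ≤ d₂ * bm t := hmt
      _ ≤ d₂ * bm s := by gcongr
      _ = d₂ / d₁ * (d₁ * bm s) := by field_simp
      _ ≤ d₂ / d₁ * (s⁻¹ * b s) := by gcongr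
    calc s * b t = s * t * (t⁻¹ * b t) := by field_simp
      _ ≤ s * t * (d₂ / d₁ * (s⁻¹ * b s)) := by gcongr
      _ = d₂ / d₁ * (t * b s) := by field_simp
      _ ≤ (c₂ / c₁ + d₂ / d₁) * (t * b s) := by
        gcongr
        exact le_add_of_nonneg_left (by positivity)

/-- A slowly varying function with a positive limit at `0⁺`, extended by that limit, is bounded
above and away from `0` on every half-line `(-∞, M]`. -/
lemma SlowlyVarying.exists_bounds_of_le {b : ℝ → ℝ} (hb : SlowlyVarying b)
    {L : ℝ} (hL : 0 < L) (hlim : Tendsto b (𝓝[>] (0:ℝ)) (𝓝 L))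
    (hext : ∀ s : ℝ, s ≤ 0 → b s = L) (M : ℝ) :
    ∃ m N : ℝ, 0 < m ∧ 0 < N ∧ ∀ t ≤ M, m ≤ b t ∧ b t ≤ N := by
  obtain ⟨K, hK, hratio⟩ := hb.exists_ratio_bound
  have hnear : ∀ᶠ t in 𝓝[>] (0:ℝ), b t ∈ Ioo (L / 2) (2 * L) :=
    hlim (Ioo_mem_nhds (by linarith) (by linarith))
  obtain ⟨δ, hδ, hnear⟩ := mem_nhdsGT_iff_exists_Ioo_subset.1 hnear
  have hδ : 0 < δ := hδ
  have hbδ := hb.2.1 δ hδ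
  set R := max M δ
  have hR : 0 < R := hδ.trans_le (le_max_right _ _)
  refine ⟨min (L / 2) (δ * b δ / (K * R)), max (2 * L) (K * (R * b δ) / δ),
    by positivity, by positivity, fun t ht => ?_⟩
  rcases le_or_gt t 0 with h0 | h0
  · rw [hext t h0]
    exact ⟨(min_le_left _ _).trans (by linarith), le_trans (by linarith) (le_max_left _ _)⟩
  rcases lt_or_ge t δ with h1 | h1
  · have h : b t ∈ Ioo (L / 2) (2 * L) := hnear ⟨h0, h1⟩
    exact ⟨(min_le_left _ _).trans h.1.le, h.2.le.trans (le_max_left _ _)⟩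
  · have hbt := hb.2.1 t h0
    have htR : t ≤ R := ht.trans (le_max_left _ _)
    obtain ⟨h₁, h₂⟩ := hratio δ t hδ h1
    refine ⟨(min_le_right _ _).trans ?_, le_trans ?_ (le_max_right _ _)⟩
    · rw [div_le_iff₀ (by positivity)]
      calc δ * b δ ≤ K * (t * b t) := h₁
        _ ≤ K * (R * b t) := by gcongr
        _ = b t * (K * R) := by ring
    · rw [le_div_iff₀ hδ]
      calc b t * δ = δ * b t := mul_comm _ _
        _ ≤ K * (t * b δ) := h₂
        _ ≤ K * (R * b δ) := by gcongr

/-- `≈` is preserved on the left by functions of comparable size, after multiplication by a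
nonnegative weight. -/
lemma EquivOn.mul_of_ratio_bound {w f g h : ℝ → ℝ} {S : Set ℝ} {C : ℝ} (hC : 0 < C)
    (hw : ∀ t ∈ S, 0 ≤ w t) (hf : ∀ t ∈ S, 0 < f t)
    (hfg : ∀ t ∈ S, C⁻¹ ≤ g t / f t ∧ g t / f t ≤ C) (hh : ∀ t ∈ S, 0 < h t)
    (hfh : EquivOn (fun t => w t * f t) h S) : EquivOn (fun t => w t * g t) h S := by
  obtain ⟨c₁, c₂, hc₁, hc, hfh⟩ := hfh
  have hc₂ : 0 < c₂ := hc₁.trans_le hc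
  refine ⟨min (C⁻¹ * c₁) (C * c₂), C * c₂, by positivity, min_le_right _ _, fun t ht => ?_⟩
  obtain ⟨h₁, h₂⟩ := hfg t ht
  rw [le_div_iff₀ (hf t ht)] at h₁
  rw [div_le_iff₀ (hf t ht)] at h₂
  have hwt := hw t ht
  have hht := hh t ht
  constructor
  · calc min (C⁻¹ * c₁) (C * c₂) * h t ≤ C⁻¹ * c₁ * h t := by gcongr; exact min_le_left _ _
      _ = C⁻¹ * (c₁ * h t) := by ring
      _ ≤ C⁻¹ * (w t * f t) := mul_le_mul_of_nonneg_left (hfh t ht).1 (by positivity)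
      _ = w t * (C⁻¹ * f t) := by ring
      _ ≤ w t * g t := by gcongr
  · calc w t * g t ≤ w t * (C * f t) := by gcongr
      _ = C * (w t * f t) := by ring
      _ ≤ C * (c₂ * h t) := mul_le_mul_of_nonneg_left (hfh t ht).2 hC.le
      _ = C * c₂ * h t := by ring

/-- Shift estimate: if `b` is slowly varying, `b(t) → L ∈ (0,∞)` as `t → 0⁺`, and `b ≡ L`
on `(-∞,0]`, then for every `t₀ > 0` there is `C > 0` such that
`C⁻¹ ≤ b (t - t₁) / b t ≤ C` for every `t₁ ∈ [-t₀, t₀]` and every `t ∈ (0,∞)`; in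
particular, every shift of `b` is slowly varying. -/
theorem slowlyVarying_shift (b : ℝ → ℝ) (hb : SlowlyVarying b)
    (L : ℝ) (hL : 0 < L) (hlim : Tendsto b (𝓝[>] (0:ℝ)) (𝓝 L))
    (hext : ∀ s : ℝ, s ≤ 0 → b s = L) :
    (∀ t₀ : ℝ, 0 < t₀ → ∃ C : ℝ, 0 < C ∧ ∀ t₁ ∈ Icc (-t₀) t₀, ∀ t ∈ Ioi (0:ℝ),
      C⁻¹ ≤ b (t - t₁) / b t ∧ b (t - t₁) / b t ≤ C) ∧
    ∀ t₁ : ℝ, SlowlyVarying (fun t => b (t - t₁)) := by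
  have hposall : ∀ s : ℝ, 0 < b s := fun s =>
    (le_or_gt s 0).elim (fun h => (hext s h).symm ▸ hL) (hb.2.1 s)
  have hshift : ∀ t₀ : ℝ, 0 < t₀ → ∃ C : ℝ, 0 < C ∧ ∀ t₁ ∈ Icc (-t₀) t₀, ∀ t ∈ Ioi (0:ℝ),
      C⁻¹ ≤ b (t - t₁) / b t ∧ b (t - t₁) / b t ≤ C := by
    intro t₀ ht₀
    obtain ⟨K, hK, hratio⟩ := hb.exists_ratio_bound
    obtain ⟨m, N, hm, hN, hmN⟩ := hb.exists_bounds_of_le hL hlim hext (3 * t₀)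
    refine ⟨max (N / m) (2 * K), by positivity, fun t₁ ht₁ t ht => ?_⟩
    have ht : 0 < t := ht
    have hbt := hposall t
    have hbs := hposall (t - t₁)
    suffices h : b (t - t₁) ≤ max (N / m) (2 * K) * b t ∧
        b t ≤ max (N / m) (2 * K) * b (t - t₁) by
      constructor
      · rw [le_div_iff₀ hbt, inv_mul_le_iff₀ (by positivity)]
        exact h.2
      · rw [div_le_iff₀ hbt]
        exact h.1
    rcases le_or_gt t (2 * t₀) with h | h
    · have bound : ∀ x y : ℝ, x ≤ 3 * t₀ → y ≤ 3 * t₀ →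
          b x ≤ max (N / m) (2 * K) * b y := fun x y hx hy => calc
        b x ≤ N := (hmN x hx).2
        _ = N / m * m := by field_simp
        _ ≤ max (N / m) (2 * K) * b y := by
          gcongr
          exacts [le_max_left _ _, (hmN y hy).1]
      exact ⟨bound _ _ (by linarith [ht₁.1]) (by linarith),
        bound _ _ (by linarith) (by linarith [ht₁.1])⟩
    · have bound : ∀ x y : ℝ, 0 < x → 0 < y → x ≤ 2 * y → y ≤ 2 * x →
          b x ≤ max (N / m) (2 * K) * b y := by
        intro x y hx hy hxy hyx
        have hbx := hposall x
        have hby := hposall y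
        have hle : b x ≤ 2 * K * b y := by
          rcases le_total x y with hc | hc
          · refine le_of_mul_le_mul_left ?_ hx
            calc x * b x ≤ K * (y * b y) := (hratio x y hx hc).1
              _ ≤ K * (2 * x * b y) := by gcongr
              _ = x * (2 * K * b y) := by ring
          · refine le_of_mul_le_mul_left ?_ hy
            calc y * b x ≤ K * (x * b y) := (hratio y x hy hc).2
              _ ≤ K * (2 * y * b y) := by gcongr
              _ = y * (2 * K * b y) := by ring
        refine hle.trans ?_
        gcongr
        exact le_max_right _ _
      have h₁ := ht₁.1
      have h₂ := ht₁.2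
      exact ⟨bound _ _ (by linarith) ht (by linarith) (by linarith),
        bound _ _ ht (by linarith) (by linarith) (by linarith)⟩
  refine ⟨hshift, fun t₁ => ⟨hb.1.comp (measurable_id.sub_const t₁),
    fun t _ => hposall _, fun ε hε => ?_⟩⟩
  obtain ⟨C, hC, hbound⟩ := hshift (|t₁| + 1) (by positivity)
  have hCt := hbound t₁ ⟨by linarith [neg_abs_le t₁], by linarith [le_abs_self t₁]⟩
  obtain ⟨bp, bm, hmono, hanti, hbp, hbm, hp, hm⟩ := hb.2.2 ε hε
  exact ⟨bp, bm, hmono, hanti, hbp, hbm,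
    hp.mul_of_ratio_bound hC (fun t ht => Real.rpow_nonneg (le_of_lt ht) _) hb.2.1 hCt hbp,
    hm.mul_of_ratio_bound hC (fun t ht => Real.rpow_nonneg (le_of_lt ht) _) hb.2.1 hCt hbm⟩
end
end

section
/- Let b be a slowly varying function such that lim_{t → 0⁺} b(t) exists and lies in (0,∞). Then there exists a function c : (0,∞) → (0,∞) such that c ≈ b on (0,∞), c has continuous classical derivatives of all orders (c is C^∞), and lim_{t → 0⁺} c(t) exists and lies in (0,∞). -/
open MeasureTheory Set Filter Topology

noncomputable section

/-- A function equivalent to a non-decreasing function is almost increasing. -/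
theorem EquivOn.exists_le_mul_of_monotoneOn {f g : ℝ → ℝ} (hg : MonotoneOn g (Ioi 0))
    (hfg : EquivOn f g (Ioi 0)) :
    ∃ K : ℝ, 0 < K ∧ ∀ s t : ℝ, 0 < s → s ≤ t → f s ≤ K * f t := by
  obtain ⟨C₁, C₂, h₁, h₁₂, h⟩ := hfg
  have h₂ : 0 < C₂ := h₁.trans_le h₁₂
  refine ⟨C₂ / C₁, by positivity, fun s t hs hst => ?_⟩
  have ht : 0 < t := hs.trans_le hst
  calc f s ≤ C₂ * g s := (h s hs).2
    _ ≤ C₂ * g t := by gcongr; exact hg hs ht hst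
    _ = C₂ / C₁ * (C₁ * g t) := by field_simp
    _ ≤ C₂ / C₁ * f t := by gcongr; exact (h t ht).1

/-- A function equivalent to a non-increasing function is almost decreasing. -/
theorem EquivOn.exists_le_mul_of_antitoneOn {f g : ℝ → ℝ} (hg : AntitoneOn g (Ioi 0))
    (hfg : EquivOn f g (Ioi 0)) :
    ∃ K : ℝ, 0 < K ∧ ∀ s t : ℝ, 0 < s → s ≤ t → f t ≤ K * f s := by
  obtain ⟨C₁, C₂, h₁, h₁₂, h⟩ := hfg
  have h₂ : 0 < C₂ := h₁.trans_le h₁₂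
  refine ⟨C₂ / C₁, by positivity, fun s t hs hst => ?_⟩
  have ht : 0 < t := hs.trans_le hst
  calc f t ≤ C₂ * g t := (h t ht).2
    _ ≤ C₂ * g s := by gcongr; exact hg hs ht hst
    _ = C₂ / C₁ * (C₁ * g s) := by field_simp
    _ ≤ C₂ / C₁ * f s := by gcongr; exact (h s hs).1

/-- The values of a slowly varying function at points whose ratio lies in `[1/2, 2]` are
comparable, uniformly on `(0,∞)`. -/
theorem SlowlyVarying.exists_forall_le_mul {b : ℝ → ℝ} (hb : SlowlyVarying b) :
    ∃ M : ℝ, 2 ≤ M ∧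
      ∀ s t : ℝ, 0 < s → 0 < t → s ≤ 2 * t → t ≤ 2 * s → b s ≤ M * b t := by
  obtain ⟨-, hpos, h⟩ := hb
  obtain ⟨bp, bm, hbp, hbm, -, -, hp, hm⟩ := h 1 one_pos
  obtain ⟨K, hK, hKb⟩ := hp.exists_le_mul_of_monotoneOn hbp
  obtain ⟨K', hK', hKb'⟩ := hm.exists_le_mul_of_antitoneOn hbm
  simp only [Real.rpow_one, Real.rpow_neg_one] at hKb hKb'
  refine ⟨2 + 2 * K + 2 * K', by linarith, fun s t hs ht hst hts => ?_⟩
  have hbt : 0 < b t := hpos t ht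
  rcases le_total s t with hle | hle
  · have h2 : s * b s ≤ s * (2 * K * b t) := calc
      s * b s ≤ K * (t * b t) := hKb s t hs hle
      _ ≤ K * (2 * s * b t) := by gcongr
      _ = s * (2 * K * b t) := by ring
    have h3 := le_of_mul_le_mul_left h2 hs
    have : 0 < K' * b t := by positivity
    linarith
  · have h2 : s⁻¹ * b s ≤ s⁻¹ * (2 * K' * b t) := calc
      s⁻¹ * b s ≤ K' * (t⁻¹ * b t) := hKb' t s ht hle
      _ ≤ K' * (2 * s⁻¹ * b t) := by
        gcongr
        rw [inv_le_iff_one_le_mul₀ ht, mul_assoc, mul_left_comm, ← div_eq_inv_mul,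
          one_le_div hs]
        exact hst
      _ = s⁻¹ * (2 * K' * b t) := by ring
    have h3 := le_of_mul_le_mul_left h2 (inv_pos.2 hs)
    have : 0 < K * b t := by positivity
    linarith

/-- A slowly varying function with a finite positive limit at `0⁺` is equivalent to a
`C^∞` function on `(0,∞)` which also has a finite positive limit at `0⁺`. -/
theorem slowlyVarying_smooth_approx_limit (b : ℝ → ℝ) (hb : SlowlyVarying b)
    (L : ℝ) (hL : 0 < L) (hlim : Tendsto b (𝓝[>] (0:ℝ)) (𝓝 L)) :
    ∃ c : ℝ → ℝ, (∀ t ∈ Ioi (0:ℝ), 0 < c t) ∧ EquivOn c b (Ioi 0) ∧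
      ContDiffOn ℝ (⊤ : ℕ∞) c (Ioi 0) ∧
      ∃ L' : ℝ, 0 < L' ∧ Tendsto c (𝓝[>] (0:ℝ)) (𝓝 L') := by
  obtain ⟨M, hM, hMb⟩ := hb.exists_forall_le_mul
  have hpos : ∀ t, 0 < t → 0 < b t := hb.2.1
  have hM0 : 0 < M := by linarith
  obtain ⟨δ, hδ, hδb⟩ : ∃ δ : ℝ, 0 < δ ∧ ∀ x ∈ Ioo 0 δ, L / 2 < b x ∧ b x < 2 * L := by
    have := hlim.eventually (Ioo_mem_nhds (half_lt_self hL) (by linarith : L < 2 * L))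
    obtain ⟨δ, hδ, h⟩ := mem_nhdsGT_iff_exists_Ioo_subset.1 this
    exact ⟨δ, hδ, fun x hx => h hx⟩
  let S : ℝ → Set ℝ := fun x =>
    {y | x < δ / 2 → y = L} ∩ {y | 0 < x → M⁻¹ * b x ≤ y ∧ y ≤ M * b x}
  have hS : ∀ x, Convex ℝ (S x) := by
    intro x
    by_cases hx : x < δ / 2 <;> by_cases hx' : 0 < x <;> simp only [S, hx, hx', forall_const,
      false_imp_iff, ofPred_true, inter_univ, univ_inter]
    · exact (convex_singleton L).inter (convex_Icc _ _)
    · exact convex_singleton L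
    · exact convex_Icc (M⁻¹ * b x) (M * b x)
    · exact convex_univ
  have hloc : ∀ x : ℝ, ∃ y : ℝ, ∀ᶠ z in 𝓝 x, y ∈ S z := by
    intro x
    rcases lt_or_ge x δ with hx | hx
    · refine ⟨L, (eventually_lt_nhds hx).mono fun z hz => ⟨fun _ => rfl, fun hz0 => ?_⟩⟩
      obtain ⟨h1, h2⟩ := hδb z ⟨hz0, hz⟩
      rw [inv_mul_le_iff₀ hM0]
      constructor <;> nlinarith
    · have hx0 : 0 < x := hδ.trans_le hx
      have hI : Ioo (x / 2) (2 * x) ∈ 𝓝 x := Ioo_mem_nhds (by linarith) (by linarith)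
      refine ⟨b x, mem_of_superset hI fun z hz => ⟨fun h => ?_, fun hz0 => ?_⟩⟩
      · linarith [hz.1]
      · rw [inv_mul_le_iff₀ hM0]
        have h1 := hz.1
        have h2 := hz.2
        exact ⟨hMb z x hz0 hx0 h2.le (by linarith), hMb x z hx0 hz0 (by linarith) h2.le⟩
  obtain ⟨c, hc⟩ := exists_contMDiffMap_forall_mem_convex_of_local_const (n := (⊤ : ℕ∞))
    (modelWithCornersSelf ℝ ℝ) hS hloc
  have hcb : ∀ t, 0 < t → M⁻¹ * b t ≤ c t ∧ c t ≤ M * b t := fun t ht => (hc t).2 ht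
  refine ⟨c, fun t ht => ?_, ⟨M⁻¹, M, by positivity, ?_, hcb⟩,
    c.contMDiff.contDiff.contDiffOn, L, hL, ?_⟩
  · have := hpos t ht
    exact lt_of_lt_of_le (by positivity) (hcb t ht).1
  · exact (inv_le_one_of_one_le₀ (by linarith)).trans (by linarith)
  · refine tendsto_const_nhds.congr' (mem_nhdsWithin_of_mem_nhds ?_)
    exact (eventually_lt_nhds (half_pos hδ)).mono fun z hz => ((hc z).1 hz).symm
end
end

section
/- Let b₁ and b₂ be slowly varying functions such that for i = 1, 2 the limit lim_{t → 0⁺} b_i(t) exists and lies in (0,∞). Define b : (0,∞) → (0,∞) by b(t) = b₂(1/t − 1) for t < 1, b(1) = 1, and b(t) = b₁(t − 1) for t > 1. Then b is slowly varying, b ≈ (t ↦ b₂(1/t)) on (0,1), and b ≈ b₁ on (1,∞). -/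
open MeasureTheory Set Filter Topology

noncomputable section

/-- A positive function that is monotone up to a constant with respect to a preorder `r` is
equivalent to a genuinely monotone positive function. -/
theorem exists_equivOn_of_quasiMonotone {f : ℝ → ℝ} {S : Set ℝ} {C : ℝ} (r : ℝ → ℝ → Prop)
    (hrefl : ∀ t, r t t) (htrans : ∀ s t u, r s t → r t u → r s u)
    (hC : 1 ≤ C) (hpos : ∀ t ∈ S, 0 < f t)
    (hf : ∀ s ∈ S, ∀ t ∈ S, r s t → f s ≤ C * f t) :
    ∃ g : ℝ → ℝ, (∀ s ∈ S, ∀ t ∈ S, r s t → g s ≤ g t) ∧ (∀ t ∈ S, 0 < g t) ∧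
      EquivOn f g S := by
  have hbdd : ∀ t ∈ S, BddAbove (f '' {s | s ∈ S ∧ r s t}) := by
    rintro t ht
    refine ⟨C * f t, ?_⟩
    rintro _ ⟨s, ⟨hs, hst⟩, rfl⟩
    exact hf s hs t ht hst
  have hmem : ∀ t ∈ S, f t ∈ f '' {s | s ∈ S ∧ r s t} := fun t ht => ⟨t, ⟨ht, hrefl t⟩, rfl⟩
  have hle : ∀ t ∈ S, f t ≤ sSup (f '' {s | s ∈ S ∧ r s t}) := fun t ht =>
    le_csSup (hbdd t ht) (hmem t ht)
  have hge : ∀ t ∈ S, sSup (f '' {s | s ∈ S ∧ r s t}) ≤ C * f t := by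
    intro t ht
    refine csSup_le ⟨_, hmem t ht⟩ ?_
    rintro _ ⟨s, ⟨hs, hst⟩, rfl⟩
    exact hf s hs t ht hst
  refine ⟨fun t => sSup (f '' {s | s ∈ S ∧ r s t}), ?_, fun t ht => (hpos t ht).trans_le (hle t ht),
    C⁻¹, 1, by positivity, inv_le_one_of_one_le₀ hC, fun t ht => ⟨?_, ?_⟩⟩
  · intro s hs t ht hst
    refine csSup_le_csSup (hbdd t ht) ⟨_, hmem s hs⟩ (image_mono ?_)
    rintro u ⟨hu, hus⟩
    exact ⟨hu, htrans _ _ _ hus hst⟩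
  · rw [inv_mul_le_iff₀ (by linarith)]
    exact hge t ht
  · simpa using hle t ht

/-- A function equivalent to an `r`-monotone one is `r`-monotone up to a constant. -/
theorem EquivOn.quasiMonotone {f g : ℝ → ℝ} {S : Set ℝ} (h : EquivOn f g S)
    (r : ℝ → ℝ → Prop) (hg : ∀ s ∈ S, ∀ t ∈ S, r s t → g s ≤ g t) :
    ∃ C : ℝ, 1 ≤ C ∧ ∀ s ∈ S, ∀ t ∈ S, r s t → f s ≤ C * f t := by
  obtain ⟨A, B, hA, hAB, h⟩ := h
  refine ⟨B / A, (one_le_div hA).2 hAB, fun s hs t ht hst => ?_⟩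
  calc f s ≤ B * g s := (h s hs).2
    _ ≤ B * g t := mul_le_mul_of_nonneg_left (hg s hs t ht hst) (hA.trans_le hAB).le
    _ = B / A * (A * g t) := by field_simp
    _ ≤ B / A * f t :=
      mul_le_mul_of_nonneg_left (h t ht).1 (div_pos (hA.trans_le hAB) hA).le

/-- Slow variation expressed by Potter-type bounds. -/
theorem slowlyVarying_iff_potter {b : ℝ → ℝ} :
    SlowlyVarying b ↔ Measurable b ∧ (∀ t ∈ Ioi (0 : ℝ), 0 < b t) ∧
      ∀ ε : ℝ, 0 < ε → ∃ C : ℝ, 1 ≤ C ∧ ∀ s t : ℝ, 0 < s → s ≤ t →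
        b s ≤ C * (t / s) ^ ε * b t ∧ b t ≤ C * (t / s) ^ ε * b s := by
  refine and_congr_right fun _ => and_congr_right fun hpos =>
    forall_congr' fun ε => imp_congr_right fun _ => ⟨?_, ?_⟩
  · rintro ⟨bp, bm, hbp, hbm, -, -, hp, hm⟩
    obtain ⟨C, hC, h⟩ := hp.quasiMonotone (· ≤ ·) fun s hs t ht hst => hbp hs ht hst
    obtain ⟨D, hD, h'⟩ := hm.quasiMonotone (· ≥ ·) fun s hs t ht hst => hbm ht hs hst
    refine ⟨max C D, hC.trans (le_max_left _ _), fun s t hs hst => ?_⟩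
    have ht := hs.trans_le hst
    have hbs := hpos s hs
    have hbt := hpos t ht
    have hsε := Real.rpow_pos_of_pos hs ε
    have htε := Real.rpow_pos_of_pos ht ε
    have h₁ := h s hs t ht hst
    have h₂ := h' t ht s hs hst
    simp only [Real.rpow_neg hs.le, Real.rpow_neg ht.le] at h₁ h₂
    rw [Real.div_rpow ht.le hs.le]
    constructor
    · calc b s = (s ^ ε)⁻¹ * (s ^ ε * b s) := by field_simp
        _ ≤ (s ^ ε)⁻¹ * (C * (t ^ ε * b t)) := by gcongr
        _ = C * (t ^ ε / s ^ ε) * b t := by field_simp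
        _ ≤ _ := by gcongr; exact le_max_left _ _
    · calc b t = t ^ ε * ((t ^ ε)⁻¹ * b t) := by field_simp
        _ ≤ t ^ ε * (D * ((s ^ ε)⁻¹ * b s)) := by gcongr
        _ = D * (t ^ ε / s ^ ε) * b s := by field_simp
        _ ≤ _ := by gcongr; exact le_max_right _ _
  · rintro ⟨C, hC, h⟩
    obtain ⟨bp, hbp, hbp0, hp⟩ := exists_equivOn_of_quasiMonotone
      (f := fun t => t ^ ε * b t) (S := Ioi 0) (· ≤ ·) le_refl (fun _ _ _ => le_trans) hC
      (fun t ht => mul_pos (Real.rpow_pos_of_pos ht ε) (hpos t ht)) (by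
        intro s hs t ht hst
        have hsε := Real.rpow_pos_of_pos hs ε
        have h₁ := (h s t hs hst).1
        rw [Real.div_rpow (le_of_lt ht) (le_of_lt hs)] at h₁
        calc s ^ ε * b s ≤ s ^ ε * (C * (t ^ ε / s ^ ε) * b t) := by gcongr
          _ = C * (t ^ ε * b t) := by field_simp)
    obtain ⟨bm, hbm, hbm0, hm⟩ := exists_equivOn_of_quasiMonotone
      (f := fun t => t ^ (-ε) * b t) (S := Ioi 0) (· ≥ ·) le_refl
      (fun _ _ _ h₁ h₂ => le_trans h₂ h₁) hC
      (fun t ht => mul_pos (Real.rpow_pos_of_pos ht _) (hpos t ht)) (by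
        intro t ht s hs hst
        have hsε := Real.rpow_pos_of_pos hs ε
        have htε := Real.rpow_pos_of_pos ht ε
        have h₁ := (h s t hs hst).2
        rw [Real.div_rpow (le_of_lt ht) (le_of_lt hs)] at h₁
        rw [Real.rpow_neg (le_of_lt hs), Real.rpow_neg (le_of_lt ht)]
        calc (t ^ ε)⁻¹ * b t ≤ (t ^ ε)⁻¹ * (C * (t ^ ε / s ^ ε) * b s) := by gcongr
          _ = C * ((s ^ ε)⁻¹ * b s) := by field_simp)
    exact ⟨bp, bm, fun s hs t ht hst => hbp s hs t ht hst,
      fun s hs t ht hst => hbm t ht s hs hst, hbp0, hbm0, hp, hm⟩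

/-- A slowly varying function with a positive limit at `0⁺`, extended to `0` by the value `1`,
satisfies Potter-type bounds in the variable `1 + x` on `[0,∞)`. -/
theorem SlowlyVarying.potter_one_add {b : ℝ → ℝ} (h : SlowlyVarying b) {L : ℝ} (hL : 0 < L)
    (hlim : Tendsto b (𝓝[>] (0 : ℝ)) (𝓝 L)) {ε : ℝ} (hε : 0 < ε) :
    ∃ C : ℝ, 1 ≤ C ∧ ∀ x y : ℝ, 0 ≤ x → x ≤ y →
      (if x = 0 then 1 else b x) ≤ C * ((1 + y) / (1 + x)) ^ ε * (if y = 0 then 1 else b y) ∧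
      (if y = 0 then 1 else b y) ≤ C * ((1 + y) / (1 + x)) ^ ε * (if x = 0 then 1 else b x) := by
  obtain ⟨-, hpos, hpot⟩ := slowlyVarying_iff_potter.1 h
  obtain ⟨C, hC, hpot⟩ := hpot ε hε
  obtain ⟨δ, hδ, hδ1, hbd⟩ : ∃ δ : ℝ, 0 < δ ∧ δ ≤ 1 ∧
      ∀ x, 0 < x → x ≤ δ → L / 2 < b x ∧ b x < 2 * L := by
    have hev := hlim.eventually (Ioo_mem_nhds (show L / 2 < L by linarith)
      (show L < 2 * L by linarith))
    obtain ⟨u, hu, hus⟩ := mem_nhdsGT_iff_exists_Ioc_subset.1 hev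
    exact ⟨min u 1, lt_min hu one_pos, min_le_right _ _,
      fun x hx hxu => hus ⟨hx, hxu.trans (min_le_left _ _)⟩⟩
  set g : ℝ → ℝ := fun x => if x = 0 then 1 else b x with hg
  have hg0 : ∀ x, 0 ≤ x → 0 < g x := by
    intro x hx
    rcases hx.eq_or_lt with rfl | hx
    · simp [hg]
    · simpa [hg, hx.ne'] using hpos x hx
  obtain ⟨K, hK, hKg⟩ : ∃ K : ℝ, 1 ≤ K ∧ ∀ x, 0 ≤ x →
      g x ≤ K * b (max x δ) ∧ b (max x δ) ≤ K * g x := by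
    have hδb := hbd δ hδ le_rfl
    refine ⟨4 + 2 / L + 2 * L, by have := div_pos two_pos hL; linarith, fun x hx => ?_⟩
    have hL' : 2 / L * (L / 2) = 1 := by field_simp
    have hLi : 0 < 2 / L := by positivity
    rcases hx.eq_or_lt with rfl | hx
    · rw [max_eq_right hδ.le]
      simp only [hg, if_true]
      constructor <;> nlinarith
    · have hgx : g x = b x := by simp [hg, hx.ne']
      rw [hgx]
      rcases le_total x δ with hxδ | hxδ
      · rw [max_eq_right hxδ]
        have := hbd x hx hxδ
        constructor <;> nlinarith
      · rw [max_eq_left hxδ]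
        have := hpos x hx
        constructor <;> nlinarith
  have hA : 1 ≤ (2 / δ) ^ ε := Real.one_le_rpow (by rw [le_div_iff₀ hδ]; linarith) hε.le
  refine ⟨K * K * C * (2 / δ) ^ ε, ?_, fun x y hx hxy => ?_⟩
  · exact one_le_mul_of_one_le_of_one_le
      (one_le_mul_of_one_le_of_one_le (one_le_mul_of_one_le_of_one_le hK hK) hC) hA
  have hy := hx.trans hxy
  have hx' : 0 < max x δ := hδ.trans_le (le_max_right _ _)
  have hy' : 0 < max y δ := hδ.trans_le (le_max_right _ _)
  have hratio : (max y δ / max x δ) ^ ε ≤ (2 / δ) ^ ε * ((1 + y) / (1 + x)) ^ ε := by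
    rw [← Real.mul_rpow (by positivity) (by positivity)]
    refine Real.rpow_le_rpow (by positivity) ?_ hε.le
    have h₁ : max y δ ≤ 1 + y := max_le (by linarith) (by linarith)
    have h₂ : δ / 2 * (1 + x) ≤ max x δ := by
      have := le_max_left x δ
      have := le_max_right x δ
      nlinarith
    calc max y δ / max x δ ≤ (1 + y) / (δ / 2 * (1 + x)) := by gcongr
      _ = 2 / δ * ((1 + y) / (1 + x)) := by field_simp
  have key : ∀ u v : ℝ, 0 ≤ u → 0 ≤ v →
      b (max u δ) ≤ C * (max y δ / max x δ) ^ ε * b (max v δ) →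
      g u ≤ K * K * C * (2 / δ) ^ ε * ((1 + y) / (1 + x)) ^ ε * g v := by
    intro u v hu hv huv
    have := hpos (max v δ) (hδ.trans_le (le_max_right _ _))
    have := hg0 v hv
    calc g u ≤ K * b (max u δ) := (hKg u hu).1
      _ ≤ K * (C * (max y δ / max x δ) ^ ε * b (max v δ)) := by gcongr
      _ ≤ K * (C * ((2 / δ) ^ ε * ((1 + y) / (1 + x)) ^ ε) * (K * g v)) := by
        gcongr
        exact (hKg v hv).2
      _ = _ := by ring
  have hp := hpot _ _ hx' (max_le_max_right δ hxy)
  exact ⟨key x y hx hy hp.1, key y x hy hx hp.2⟩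

/-- Shifting the argument by `1` preserves a slowly varying function with a positive limit at
`0⁺` up to equivalence. -/
theorem SlowlyVarying.exists_shift_bound {b : ℝ → ℝ} (h : SlowlyVarying b) {L : ℝ} (hL : 0 < L)
    (hlim : Tendsto b (𝓝[>] (0 : ℝ)) (𝓝 L)) :
    ∃ C₁ C₂ : ℝ, 0 < C₁ ∧ C₁ ≤ C₂ ∧
      ∀ u ∈ Ioi (1 : ℝ), C₁ * b u ≤ b (u - 1) ∧ b (u - 1) ≤ C₂ * b u := by
  obtain ⟨C, hC, hb⟩ := h.potter_one_add hL hlim one_pos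
  refine ⟨(2 * C)⁻¹, 2 * C, by positivity,
    (inv_le_one_of_one_le₀ (by linarith)).trans (by linarith), fun u (hu : 1 < u) => ?_⟩
  have hu₁ : u - 1 ≠ 0 := by linarith
  have hu₀ : u ≠ 0 := by linarith
  have hb₁ := h.2.1 (u - 1) (sub_pos.2 hu)
  have hb₀ := h.2.1 u (one_pos.trans hu)
  obtain ⟨h₁, h₂⟩ := hb (u - 1) u (by linarith) (by linarith)
  have hr : (1 + u) / (1 + (u - 1)) ≤ 2 := by
    rw [div_le_iff₀ (by linarith)]
    linarith
  simp only [Real.rpow_one, if_neg hu₁, if_neg hu₀] at h₁ h₂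
  constructor
  · rw [inv_mul_le_iff₀ (by positivity)]
    calc b u ≤ _ := h₂
      _ ≤ C * 2 * b (u - 1) := by gcongr
      _ = _ := by ring
  · calc b (u - 1) ≤ _ := h₁
      _ ≤ C * 2 * b u := by gcongr
      _ = _ := by ring

/-- Gluing two slowly varying functions with finite positive limits at `0⁺`: the glued
function is slowly varying and equivalent to `t ↦ b₂ (1/t)` on `(0,1)` and to `b₁` on
`(1,∞)`. -/
theorem slowlyVarying_glue (b₁ b₂ : ℝ → ℝ)
    (h₁ : SlowlyVarying b₁) (h₂ : SlowlyVarying b₂)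
    (L₁ L₂ : ℝ) (hL₁ : 0 < L₁) (hL₂ : 0 < L₂)
    (hlim₁ : Tendsto b₁ (𝓝[>] (0:ℝ)) (𝓝 L₁))
    (hlim₂ : Tendsto b₂ (𝓝[>] (0:ℝ)) (𝓝 L₂)) :
    SlowlyVarying
      (fun t => if t < 1 then b₂ (1 / t - 1) else if t = 1 then 1 else b₁ (t - 1)) ∧
    EquivOn (fun t => if t < 1 then b₂ (1 / t - 1) else if t = 1 then 1 else b₁ (t - 1))
      (fun t => b₂ (1 / t)) (Ioo 0 1) ∧
    EquivOn (fun t => if t < 1 then b₂ (1 / t - 1) else if t = 1 then 1 else b₁ (t - 1))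
      b₁ (Ioi 1) := by
  obtain ⟨hm₁, hp₁, -⟩ := id h₁
  obtain ⟨hm₂, hp₂, -⟩ := id h₂
  refine ⟨slowlyVarying_iff_potter.2 ⟨?_, ?_, ?_⟩, ?_, ?_⟩
  · exact Measurable.ite measurableSet_Iio (hm₂.comp (by fun_prop))
      (Measurable.ite (measurableSet_singleton 1) measurable_const (hm₁.comp (by fun_prop)))
  · intro t (ht : 0 < t)
    split_ifs with h h'
    · exact hp₂ _ (sub_pos.2 ((one_lt_div ht).2 h))
    · exact one_pos
    · exact hp₁ _ (sub_pos.2 (lt_of_le_of_ne (not_lt.1 h) (Ne.symm h')))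
  · intro ε hε
    obtain ⟨C, hC, hb₁⟩ := h₁.potter_one_add hL₁ hlim₁ hε
    obtain ⟨D, hD, hb₂⟩ := h₂.potter_one_add hL₂ hlim₂ hε
    set b : ℝ → ℝ := fun t => if t < 1 then b₂ (1 / t - 1) else if t = 1 then 1 else b₁ (t - 1)
      with hb
    have hone : b 1 = 1 := by simp [hb]
    have hleft : ∀ t, 0 < t → t ≤ 1 → (if 1 / t - 1 = 0 then 1 else b₂ (1 / t - 1)) = b t := by
      intro t ht ht1
      rcases ht1.eq_or_lt with rfl | ht1
      · simp [hb]
      · have : 1 / t - 1 ≠ 0 := (sub_pos.2 ((one_lt_div ht).2 ht1)).ne'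
        simp only [hb, if_neg this, if_pos ht1]
    have hright : ∀ t, 1 ≤ t → (if t - 1 = 0 then 1 else b₁ (t - 1)) = b t := by
      intro t ht
      simp only [hb, if_neg ht.not_gt, sub_eq_zero]
    have hlow : ∀ s t, 0 < s → s ≤ t → t ≤ 1 →
        b s ≤ D * (t / s) ^ ε * b t ∧ b t ≤ D * (t / s) ^ ε * b s := by
      intro s t hs hst ht1
      have ht := hs.trans_le hst
      have := hb₂ (1 / t - 1) (1 / s - 1) (sub_nonneg.2 ((one_le_div ht).2 ht1))
        (sub_le_sub_right (one_div_le_one_div_of_le hs hst) 1)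
      rw [hleft s hs (hst.trans ht1), hleft t ht ht1,
        show (1 + (1 / s - 1)) / (1 + (1 / t - 1)) = t / s by
          rw [add_sub_cancel, add_sub_cancel]; field_simp] at this
      exact this.symm
    have hhigh : ∀ s t, 1 ≤ s → s ≤ t →
        b s ≤ C * (t / s) ^ ε * b t ∧ b t ≤ C * (t / s) ^ ε * b s := by
      intro s t hs hst
      have := hb₁ (s - 1) (t - 1) (sub_nonneg.2 hs) (by linarith)
      rwa [hright s hs, hright t (hs.trans hst), add_sub_cancel, add_sub_cancel] at this
    have hpos : ∀ t, 0 < t → 0 < b t := by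
      intro t ht
      rcases le_total t 1 with h1 | h1
      · have h := (hlow t 1 ht h1 le_rfl).2
        rw [hone] at h
        exact pos_of_mul_pos_right (one_pos.trans_le h) (by positivity)
      · have h := (hhigh 1 t le_rfl h1).1
        rw [hone] at h
        exact pos_of_mul_pos_right (one_pos.trans_le h) (by positivity)
    refine ⟨C * D, one_le_mul_of_one_le_of_one_le hC hD, fun s t hs hst => ?_⟩
    have ht := hs.trans_le hst
    have hbs := hpos s hs
    have hbt := hpos t ht
    have hDC : D ≤ C * D := le_mul_of_one_le_left (by linarith) hC
    have hCD : C ≤ C * D := le_mul_of_one_le_right (by linarith) hD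
    rcases le_total t 1 with ht1 | ht1
    · obtain ⟨h, h'⟩ := hlow s t hs hst ht1
      exact ⟨h.trans (by gcongr), h'.trans (by gcongr)⟩
    rcases le_total 1 s with hs1 | hs1
    · obtain ⟨h, h'⟩ := hhigh s t hs1 hst
      exact ⟨h.trans (by gcongr), h'.trans (by gcongr)⟩
    obtain ⟨h, h'⟩ := hlow s 1 hs hs1 le_rfl
    obtain ⟨k, k'⟩ := hhigh 1 t le_rfl ht1
    rw [hone] at h h' k k'
    have hsplit : (t / s) ^ ε = (t / 1) ^ ε * (1 / s) ^ ε := by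
      rw [← Real.mul_rpow (by positivity) (by positivity)]
      congr 1
      field_simp
    rw [hsplit]
    constructor
    · calc b s ≤ D * (1 / s) ^ ε * 1 := h
        _ ≤ D * (1 / s) ^ ε * (C * (t / 1) ^ ε * b t) := by gcongr
        _ = _ := by ring
    · calc b t ≤ C * (t / 1) ^ ε * 1 := k'
        _ ≤ C * (t / 1) ^ ε * (D * (1 / s) ^ ε * b s) := by gcongr
        _ = _ := by ring
  · obtain ⟨C₁, C₂, hC₁, hC, h⟩ := h₂.exists_shift_bound hL₂ hlim₂
    refine ⟨C₁, C₂, hC₁, hC, fun t ht => ?_⟩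
    simpa only [if_pos ht.2] using h (1 / t) ((one_lt_div ht.1).2 ht.2)
  · obtain ⟨C₁, C₂, hC₁, hC, h⟩ := h₁.exists_shift_bound hL₁ hlim₁
    refine ⟨C₁, C₂, hC₁, hC, fun t (ht : 1 < t) => ?_⟩
    simpa only [if_neg ht.not_gt, if_neg ht.ne'] using h t ht
end
end
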